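/- arXiv:2002.12853 — 7 statements merged into one kernel-verified Lean document; each statement's English description precedes it below -/
import Mathlib

section
/- Let 0 ≤ k₀ < k ≤ 1 satisfy 2(k − k₀) ≥ 1. For every r > 0 the function μ(r) = (r+1)^{2k} − (r+1)^{2k₀}, with derivative μ′(r) = 2k(r+1)^{2k−1} − 2k₀(r+1)^{2k₀−1}, satisfies 2μ(r) − r·μ′(r) ≥ 2(k − k₀)·r·(r+1)^{2k₀−1} > 0; in particular 2r^{−1}μ(r) − μ′(r) ≥ 0. -/
/-- Inner-region part (0 < r < a) of inequality (2.5) of Lemma 2.1. -/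
theorem stmt_0 (k k₀ : ℝ) (hk₀ : 0 ≤ k₀) (hkk : k₀ < k) (hk : k ≤ 1)
    (hν : 1 ≤ 2 * (k - k₀)) (r : ℝ) (hr : 0 < r) :
    2 * ((r + 1) ^ (2 * k) - (r + 1) ^ (2 * k₀))
        - r * (2 * k * (r + 1) ^ (2 * k - 1) - 2 * k₀ * (r + 1) ^ (2 * k₀ - 1))
      ≥ 2 * (k - k₀) * r * (r + 1) ^ (2 * k₀ - 1)
    ∧ 0 < 2 * (k - k₀) * r * (r + 1) ^ (2 * k₀ - 1)
    ∧ 2 * r⁻¹ * ((r + 1) ^ (2 * k) - (r + 1) ^ (2 * k₀))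
        - (2 * k * (r + 1) ^ (2 * k - 1) - 2 * k₀ * (r + 1) ^ (2 * k₀ - 1)) ≥ 0 := by
  have hs : 0 < r + 1 := by linarith
  have bernoulli : 1 + 2 * (k - k₀) * r ≤ (r + 1) ^ (2 * (k - k₀)) := by
    rw [add_comm r 1]
    exact one_add_mul_self_le_rpow_one_add (by linarith) hν
  have hB : 0 < (r + 1) ^ (2 * k₀ - 1) := Real.rpow_pos_of_pos hs _
  have hμ' : (r + 1) ^ (2 * k - 1) = (r + 1) ^ (2 * k₀ - 1) * (r + 1) ^ (2 * (k - k₀)) := by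
    rw [← Real.rpow_add hs]
    ring_nf
  have hpow (x : ℝ) : (r + 1) ^ x = (r + 1) ^ (x - 1) * (r + 1) := by
    rw [← Real.rpow_add_one hs.ne', sub_add_cancel]
  rw [hpow (2 * k), hpow (2 * k₀), hμ']
  generalize (r + 1) ^ (2 * k₀ - 1) = B at hB ⊢
  generalize (r + 1) ^ (2 * (k - k₀)) = t at bernoulli ⊢
  have ht : 0 ≤ t - 1 := by nlinarith
  have hcoef : 0 ≤ 2 * (r + 1) * (t - 1) - r * (2 * k * t - 2 * k₀) - 2 * (k - k₀) * r := by
    nlinarith [mul_nonneg (mul_nonneg hr.le ht) (sub_nonneg.2 hk)]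
  have hpos : 0 < 2 * (k - k₀) * r * B := by
    have : 0 < k - k₀ := sub_pos.2 hkk
    positivity
  have hmain : 2 * (B * t * (r + 1) - B * (r + 1)) - r * (2 * k * (B * t) - 2 * k₀ * B)
      ≥ 2 * (k - k₀) * r * B := by
    linarith [mul_nonneg hB.le hcoef]
  refine ⟨hmain, hpos, ?_⟩
  have hdiv := mul_nonneg (inv_nonneg.2 hr.le) (hpos.le.trans hmain)
  rwa [mul_sub, inv_mul_cancel_left₀ hr.ne', mul_left_comm, ← mul_assoc] at hdiv
end

section
/- Let 0 ≤ k₀ < k ≤ 1, s > 1/2 and a > 1 satisfy (a+1)^{2k} − (a+1)^{2k₀} ≥ s. For r > a define μ(r) = (a+1)^{2k} − (a+1)^{2k₀} + (a+1)^{1−2s} − (r+1)^{1−2s} and μ′(r) = (2s−1)(r+1)^{−2s}. Then for all r > a: 2r^{−1}μ(r) − μ′(r) ≥ 2r^{−1}((a+1)^{2k} − (a+1)^{2k₀} − s) ≥ 0. -/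
/-- Outer-region part (r > a) of inequality (2.5) of Lemma 2.1. -/
theorem stmt_1 (k k₀ s a : ℝ) (hk₀ : 0 ≤ k₀) (hkk : k₀ < k) (hk : k ≤ 1)
    (hs : 1 / 2 < s) (ha : 1 < a)
    (hcond : (a + 1) ^ (2 * k) - (a + 1) ^ (2 * k₀) ≥ s)
    (r : ℝ) (hr : a < r) :
    2 * r⁻¹ * ((a + 1) ^ (2 * k) - (a + 1) ^ (2 * k₀)
          + (a + 1) ^ (1 - 2 * s) - (r + 1) ^ (1 - 2 * s))
        - (2 * s - 1) * (r + 1) ^ (-(2 * s))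
      ≥ 2 * r⁻¹ * ((a + 1) ^ (2 * k) - (a + 1) ^ (2 * k₀) - s)
    ∧ 2 * r⁻¹ * ((a + 1) ^ (2 * k) - (a + 1) ^ (2 * k₀) - s) ≥ 0 := by
  have hr0 : 0 < r := by linarith
  have hmono : (r + 1) ^ (1 - 2 * s) ≤ (a + 1) ^ (1 - 2 * s) :=
    Real.rpow_le_rpow_of_nonpos (by linarith) (by linarith) (by linarith)
  have hpow : r * (r + 1) ^ (-(2 * s)) ≤ 1 := by
    have hpos : 0 < (r + 1) ^ (-(2 * s)) := Real.rpow_pos_of_pos (by linarith) _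
    have hle : (r + 1) ^ (1 - 2 * s) ≤ 1 :=
      Real.rpow_le_one_of_one_le_of_nonpos (by linarith) (by linarith)
    have hsplit : (r + 1) ^ (1 - 2 * s) = (r + 1) * (r + 1) ^ (-(2 * s)) := by
      rw [sub_eq_add_neg, Real.rpow_add (by linarith), Real.rpow_one]
    linarith
  have hkey : (2 * s - 1) * (r + 1) ^ (-(2 * s))
      ≤ 2 * r⁻¹ * (s + (a + 1) ^ (1 - 2 * s) - (r + 1) ^ (1 - 2 * s)) := by
    have hmul : (2 * s - 1) * (r * (r + 1) ^ (-(2 * s))) ≤ (2 * s - 1) * 1 :=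
      mul_le_mul_of_nonneg_left hpow (by linarith)
    rw [mul_comm 2 r⁻¹, mul_assoc, ← div_eq_inv_mul, le_div_iff₀ hr0]
    linarith
  refine ⟨by linarith, mul_nonneg (by positivity) (by linarith)⟩
end

section
/- Let 0 ≤ k₀ < k ≤ 1, s > 1/2, a > 1 with (a+1)^{2k} − (a+1)^{2k₀} ≥ s, and let j ≥ 0. Then there exists a constant C > 0 depending only on k, k₀, s and j (and not on a) such that μ(r)^j / μ′(r) ≤ C a^{2kj} (r+1)^{2s} for all r > 0 with r ≠ a. -/
/-- The weight function μ of the paper. -/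
noncomputable def mu (k k₀ s a r : ℝ) : ℝ :=
  if r ≤ a then (r + 1) ^ (2 * k) - (r + 1) ^ (2 * k₀)
  else (a + 1) ^ (2 * k) - (a + 1) ^ (2 * k₀) + (a + 1) ^ (1 - 2 * s) - (r + 1) ^ (1 - 2 * s)

/-- The derivative μ′ of the weight function (for r ≠ a). -/
noncomputable def muDeriv (k k₀ s a r : ℝ) : ℝ :=
  if r < a then 2 * k * (r + 1) ^ (2 * k - 1) - 2 * k₀ * (r + 1) ^ (2 * k₀ - 1)
  else (2 * s - 1) * (r + 1) ^ (-(2 * s))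

/-- The weight is nonnegative and bounded by `(a + 1) ^ (2 * k)`. -/
lemma mu_mem_Icc {k k₀ s a r : ℝ} (hk₀ : 0 ≤ k₀) (hkk : k₀ < k) (hs : 1 / 2 < s)
    (ha : 1 < a) (hr : 0 < r) :
    mu k k₀ s a r ∈ Set.Icc 0 ((a + 1) ^ (2 * k)) := by
  unfold mu
  split_ifs with h
  · have h1 : (r + 1) ^ (2 * k₀) ≤ (r + 1) ^ (2 * k) :=
      Real.rpow_le_rpow_of_exponent_le (by linarith) (by linarith)
    have h2 : (r + 1) ^ (2 * k) ≤ (a + 1) ^ (2 * k) :=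
      Real.rpow_le_rpow (by linarith) (by linarith) (by linarith)
    have h3 : 0 ≤ (r + 1) ^ (2 * k₀) := by positivity
    constructor <;> linarith
  · push Not at h
    have h1 : (a + 1) ^ (2 * k₀) ≤ (a + 1) ^ (2 * k) :=
      Real.rpow_le_rpow_of_exponent_le (by linarith) (by linarith)
    have h2 : (r + 1) ^ (1 - 2 * s) ≤ (a + 1) ^ (1 - 2 * s) :=
      Real.rpow_le_rpow_of_nonpos (by linarith) (by linarith) (by linarith)
    have h3 : 0 ≤ (r + 1) ^ (1 - 2 * s) := by positivity
    have h4 : (a + 1) ^ (1 - 2 * s) ≤ (a + 1) ^ (2 * k₀) :=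
      Real.rpow_le_rpow_of_exponent_le (by linarith) (by linarith)
    constructor <;> linarith

/-- The derivative of the weight decays at most like `(r + 1) ^ (-(2 * s))`. -/
lemma le_muDeriv {k k₀ s a r : ℝ} (hk₀ : 0 ≤ k₀) (hkk : k₀ < k) (hs : 1 / 2 < s)
    (hr : 0 < r) :
    min (2 * (k - k₀)) (2 * s - 1) * (r + 1) ^ (-(2 * s)) ≤ muDeriv k k₀ s a r := by
  have hp : 0 < (r + 1) ^ (-(2 * s)) := by positivity
  unfold muDeriv
  split_ifs with h
  · have h1 : (r + 1) ^ (2 * k₀ - 1) ≤ (r + 1) ^ (2 * k - 1) :=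
      Real.rpow_le_rpow_of_exponent_le (by linarith) (by linarith)
    have h2 : (r + 1) ^ (-(2 * s)) ≤ (r + 1) ^ (2 * k - 1) :=
      Real.rpow_le_rpow_of_exponent_le (by linarith) (by linarith)
    calc min (2 * (k - k₀)) (2 * s - 1) * (r + 1) ^ (-(2 * s))
        ≤ 2 * (k - k₀) * (r + 1) ^ (-(2 * s)) :=
          mul_le_mul_of_nonneg_right (min_le_left _ _) hp.le
      _ ≤ 2 * (k - k₀) * (r + 1) ^ (2 * k - 1) :=
          mul_le_mul_of_nonneg_left h2 (by linarith)
      _ ≤ _ := by linarith [mul_le_mul_of_nonneg_left h1 hk₀]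
  · exact mul_le_mul_of_nonneg_right (min_le_right _ _) hp.le

/-- Inequality (2.6) of Lemma 2.1. -/
theorem stmt_2 (k k₀ s j : ℝ) (hk₀ : 0 ≤ k₀) (hkk : k₀ < k) (hk : k ≤ 1)
    (hs : 1 / 2 < s) (hj : 0 ≤ j) :
    ∃ C > 0, ∀ a : ℝ, 1 < a → (a + 1) ^ (2 * k) - (a + 1) ^ (2 * k₀) ≥ s →
      ∀ r : ℝ, 0 < r → r ≠ a →
        mu k k₀ s a r ^ j / muDeriv k k₀ s a r ≤ C * a ^ (2 * k * j) * (r + 1) ^ (2 * s) := by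
  have hc : 0 < min (2 * (k - k₀)) (2 * s - 1) := lt_min (by linarith) (by linarith)
  refine ⟨2 ^ (2 * k * j) / min (2 * (k - k₀)) (2 * s - 1), by positivity, ?_⟩
  intro a ha _ r hr _
  obtain ⟨h0, h1⟩ := mu_mem_Icc hk₀ hkk hs ha hr
  have hd := le_muDeriv (a := a) hk₀ hkk hs hr
  have hnum : mu k k₀ s a r ^ j ≤ 2 ^ (2 * k * j) * a ^ (2 * k * j) :=
    calc mu k k₀ s a r ^ j ≤ ((a + 1) ^ (2 * k)) ^ j := Real.rpow_le_rpow h0 h1 hj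
      _ = (a + 1) ^ (2 * k * j) := (Real.rpow_mul (by linarith) _ _).symm
      _ ≤ (2 * a) ^ (2 * k * j) :=
          Real.rpow_le_rpow (by linarith) (by linarith)
            (mul_nonneg (by linarith) hj)
      _ = _ := Real.mul_rpow (by norm_num) (by linarith)
  calc mu k k₀ s a r ^ j / muDeriv k k₀ s a r
      ≤ 2 ^ (2 * k * j) * a ^ (2 * k * j) /
          (min (2 * (k - k₀)) (2 * s - 1) * (r + 1) ^ (-(2 * s))) :=
        div_le_div₀ (by positivity) hnum (by positivity) hd
    _ = _ := by
        rw [Real.rpow_neg (by linarith)]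
        field_simp
end

section
/- Let E > 0, β > 1, and let p : [0,∞) → (0,∞) be nonincreasing with p(r) → 0 as r → ∞. Set k = (1/4)min{1, β−1} and k₀ = 0, fix s with 1/2 < s < (1/4)min{3, β+1} and ℓ > 0 with kℓ > 2 and (β − 2k − 2s)ℓ > 2. For τ₀ ≥ 1 put τ = τ₀ and a = τ₀^ℓ, let μ, φ, A be as in the context, and define B₁(r) = (r+1)^{−β} μ(r) + p(r) μ′(r) and B₂(r) = (μ(r)φ″(r))² / (h^{−1}φ′(r)μ(r) + μ′(r)). Then for every constant C > 0 there exists τ₁ ≥ 1, depending only on C, E, β, p, s, ℓ, such that for all τ₀ ≥ τ₁, all 0 < h ≤ 1 and all r > 0 with r ≠ a: A(r) − C(B₁(r) + B₂(r)) ≥ −(E/2) μ′(r). -/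
/-- The derivative φ′ of the phase function. -/
noncomputable def phiDeriv (k τ a r : ℝ) : ℝ :=
  if r ≤ a then τ * ((r + 1) ^ (-k) - (a + 1) ^ (-k)) else 0

/-- The second derivative φ″ of the phase function (for r ≠ a). -/
noncomputable def phiDeriv2 (k τ a r : ℝ) : ℝ :=
  if r < a then -(k * τ) * (r + 1) ^ (-k - 1) else 0

/-- A = (μ φ′²)′. -/
noncomputable def Afun (k k₀ s τ a r : ℝ) : ℝ :=
  muDeriv k k₀ s a r * phiDeriv k τ a r ^ 2
    + 2 * mu k k₀ s a r * phiDeriv k τ a r * phiDeriv2 k τ a r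

open Filter Topology

/-- The quadratic error term in the region where the phase is active, written in the variables
`y = (r + 1) ^ (-k)`, `q = (r + 1)⁻¹`, `c = (a + 1) ^ (-k)`. -/
lemma sq_div_le_of_phase_active {k τ y c q h : ℝ} (hk : 0 < k) (hτ : 0 < τ) (hc : 0 < c)
    (hcy : c < y) (hy : y < 1) (hq : 0 < q) (hqy : q ≤ y ^ 4) (hh : 0 < h) (hh1 : h ≤ 1) :
    (((y ^ 2)⁻¹ - 1) * (-(k * τ) * (y * q))) ^ 2
        / (h⁻¹ * (τ * (y - c)) * ((y ^ 2)⁻¹ - 1) + 2 * k * (q / y ^ 2))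
      ≤ 2 * k * (q / y ^ 2) * (k * τ * y ^ 4 + τ ^ 2 * c) := by
  have hy0 : 0 < y := hc.trans hcy
  have hy2 : y ^ 2 < 1 := by nlinarith
  set m := (y ^ 2)⁻¹ - 1 with hm
  have hm0 : 0 < m := sub_pos.2 ((one_lt_inv₀ (by positivity)).2 hy2)
  have hmy : m * y ^ 2 ≤ 1 := by
    rw [hm, sub_mul, inv_mul_cancel₀ (by positivity)]
    nlinarith
  set d := 2 * k * (q / y ^ 2) with hd
  have hd0 : 0 < d := by positivity
  have hdy : d * y ^ 2 = 2 * k * q := by rw [hd]; field_simp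
  have hφ : 0 < τ * (y - c) * m := mul_pos (mul_pos hτ (sub_pos.2 hcy)) hm0
  have hD : τ * (y - c) * m + d ≤ h⁻¹ * (τ * (y - c)) * m + d := by
    have : 1 ≤ h⁻¹ := (one_le_inv₀ hh).2 hh1
    nlinarith
  have hnum : (m * (-(k * τ) * (y * q))) ^ 2
      ≤ d * (k * τ * y ^ 4 + τ ^ 2 * c) * (τ * (y - c) * m + d) := by
    rcases lt_or_ge y (2 * c) with hlt | hge
    · have h1 : (m * (-(k * τ) * (y * q))) ^ 2 ≤ d * (τ ^ 2 * c) * d := by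
        have e : (m * (-(k * τ) * (y * q))) ^ 2
            = (m * y ^ 2) ^ 2 * (d ^ 2 * τ ^ 2) * (y ^ 2 / 4) := by
          have : k * q = d * y ^ 2 / 2 := by linarith
          calc (m * (-(k * τ) * (y * q))) ^ 2 = m ^ 2 * τ ^ 2 * y ^ 2 * (k * q) ^ 2 := by ring
            _ = _ := by rw [this]; ring
        have h2 : (m * y ^ 2) ^ 2 ≤ 1 := pow_le_one₀ (by positivity) hmy
        have h3 : y ^ 2 / 4 ≤ c := by nlinarith
        calc _ = (m * y ^ 2) ^ 2 * (d ^ 2 * τ ^ 2) * (y ^ 2 / 4) := e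
          _ ≤ 1 * (d ^ 2 * τ ^ 2) * c := by gcongr
          _ = _ := by ring
      have h2 : 0 ≤ d * (k * τ * y ^ 4) * (τ * (y - c) * m + d) := by positivity
      have h3 : 0 ≤ d * (τ ^ 2 * c) * (τ * (y - c) * m) := by positivity
      nlinarith
    · have h1 : m * q ≤ 2 * (y - c) := by
        calc m * q ≤ m * y ^ 4 := by gcongr
          _ = m * y ^ 2 * y ^ 2 := by ring
          _ ≤ 1 * y ^ 2 := by gcongr
          _ ≤ 2 * (y - c) := by nlinarith
      have h2 : (m * (-(k * τ) * (y * q))) ^ 2 ≤ d * (k * τ * y ^ 4) * (τ * (y - c) * m) := by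
        calc (m * (-(k * τ) * (y * q))) ^ 2 = m * k ^ 2 * τ ^ 2 * y ^ 2 * q * (m * q) := by ring
          _ ≤ m * k ^ 2 * τ ^ 2 * y ^ 2 * q * (2 * (y - c)) := by gcongr
          _ = (2 * k * q) * (k * τ * y ^ 2) * (τ * (y - c) * m) := by ring
          _ = _ := by rw [← hdy]; ring
      have h3 : 0 ≤ d * (k * τ * y ^ 4) * d := by positivity
      have h4 : 0 ≤ d * (τ ^ 2 * c) * (τ * (y - c) * m + d) := by positivity
      nlinarith
  rw [div_le_iff₀ (by linarith)]
  exact hnum.trans (mul_le_mul_of_nonneg_left hD (by positivity))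

/-- The lower bound in the region where the phase is active, written in the variables
`y = (r + 1) ^ (-k)`, `q = (r + 1)⁻¹`, `c = (a + 1) ^ (-k)`, `w = (r + 1) ^ (-β)`. -/
lemma lower_bound_of_phase_active {k τ y c q h w P C E M : ℝ} (hk : 0 < k) (hτ : 0 < τ)
    (hc : 0 < c) (hcy : c < y) (hy : y < 1) (hq : 0 < q) (hqy : q ≤ y ^ 4) (hh : 0 < h)
    (hh1 : h ≤ 1) (hw : w ≤ y ^ 4 * q) (hC : 0 < C) (hP : C * P ≤ E / 4 + M * y ^ 4)
    (hτc : (2 + C) * (τ ^ 2 * c) ≤ E / 4) (hτM : C / (2 * k) + M + C * k * τ ≤ τ ^ 2) :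
    2 * k * (q / y ^ 2) * (τ * (y - c)) ^ 2
        + 2 * ((y ^ 2)⁻¹ - 1) * (τ * (y - c)) * (-(k * τ) * (y * q))
        - C * ((w * ((y ^ 2)⁻¹ - 1) + P * (2 * k * (q / y ^ 2)))
          + (((y ^ 2)⁻¹ - 1) * (-(k * τ) * (y * q))) ^ 2
            / (h⁻¹ * (τ * (y - c)) * ((y ^ 2)⁻¹ - 1) + 2 * k * (q / y ^ 2)))
      ≥ -(E / 2) * (2 * k * (q / y ^ 2)) := by
  have hB := sq_div_le_of_phase_active hk hτ hc hcy hy hq hqy hh hh1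
  have hy0 : 0 < y := hc.trans hcy
  have hA : 2 * k * (q / y ^ 2) * (τ * (y - c)) ^ 2
        + 2 * ((y ^ 2)⁻¹ - 1) * (τ * (y - c)) * (-(k * τ) * (y * q))
      = 2 * k * (q / y ^ 2) * (τ ^ 2 * ((y - c) * (y ^ 3 - c))) := by
    field_simp
    ring
  have hm0 : 0 ≤ (y ^ 2)⁻¹ - 1 :=
    sub_nonneg.2 ((one_le_inv₀ (by positivity)).2 (by nlinarith))
  have hB1 : w * ((y ^ 2)⁻¹ - 1) ≤ 2 * k * (q / y ^ 2) * (y ^ 4 / (2 * k)) := by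
    calc w * ((y ^ 2)⁻¹ - 1) ≤ y ^ 4 * q * ((y ^ 2)⁻¹ - 1) := by gcongr
      _ ≤ y ^ 4 * q * (y ^ 2)⁻¹ := by gcongr; linarith
      _ = _ := by field_simp
  have hd0 : 0 < 2 * k * (q / y ^ 2) := by positivity
  have hpoly : y ^ 4 - 2 * c ≤ (y - c) * (y ^ 3 - c) := by
    have h3 : y ^ 3 ≤ 1 := pow_le_one₀ hy0.le hy.le
    nlinarith
  rw [hA]
  have key : -(E / 2) ≤ τ ^ 2 * ((y - c) * (y ^ 3 - c)) - C * (y ^ 4 / (2 * k)) - C * P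
      - C * (k * τ * y ^ 4 + τ ^ 2 * c) := by
    have h1 : τ ^ 2 * (y ^ 4 - 2 * c) ≤ τ ^ 2 * ((y - c) * (y ^ 3 - c)) := by gcongr
    have h2 : (C / (2 * k) + M + C * k * τ) * y ^ 4 ≤ τ ^ 2 * y ^ 4 := by gcongr
    have h3 : C * (y ^ 4 / (2 * k)) = C / (2 * k) * y ^ 4 := by ring
    linarith
  have h1 := mul_le_mul_of_nonneg_left key hd0.le
  have h2 := mul_le_mul_of_nonneg_left hB1 hC.le
  have h3 := mul_le_mul_of_nonneg_left hB hC.le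
  linarith

/-- The weighted potential term beyond the support of the phase. -/
lemma rpow_mul_mu_le {β k s a r : ℝ} (hk : 0 < k) (hs : 1 / 2 < s) (hβ : 0 < β - 2 * k - 2 * s)
    (ha : 0 < a) (har : a < r) :
    (r + 1) ^ (-β) * mu k 0 s a r ≤ a ^ (-(β - 2 * k - 2 * s)) * (r + 1) ^ (-(2 * s)) := by
  have hx : 0 < r + 1 := by linarith
  have hmu : mu k 0 s a r ≤ (r + 1) ^ (2 * k) := by
    rw [mu, if_neg (not_le.2 har), mul_zero, Real.rpow_zero]
    have h1 : (a + 1) ^ (1 - 2 * s) ≤ 1 :=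
      Real.rpow_le_one_of_one_le_of_nonpos (by linarith) (by linarith)
    have h2 : 0 < (r + 1) ^ (1 - 2 * s) := Real.rpow_pos_of_pos hx _
    have h3 : (a + 1) ^ (2 * k) ≤ (r + 1) ^ (2 * k) :=
      Real.rpow_le_rpow (by linarith) (by linarith) (by linarith)
    linarith
  calc (r + 1) ^ (-β) * mu k 0 s a r ≤ (r + 1) ^ (-β) * (r + 1) ^ (2 * k) := by gcongr
    _ = (r + 1) ^ (-(β - 2 * k - 2 * s)) * (r + 1) ^ (-(2 * s)) := by
      rw [← Real.rpow_add hx, ← Real.rpow_add hx]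
      ring_nf
    _ ≤ _ := mul_le_mul_of_nonneg_right
      (Real.rpow_le_rpow_of_nonpos ha (by linarith) (by linarith)) (Real.rpow_nonneg hx.le _)

/-- Lemma 2.3 in the Lipschitz case (potential satisfying (1.3)). -/
theorem stmt_7 (E β : ℝ) (hE : 0 < E) (hβ : 1 < β)
    (p : ℝ → ℝ) (hp_pos : ∀ r : ℝ, 0 ≤ r → 0 < p r)
    (hp_mono : ∀ r r' : ℝ, 0 ≤ r → r ≤ r' → p r' ≤ p r)
    (hp_lim : Filter.Tendsto p Filter.atTop (nhds 0))
    (k k₀ s ℓ : ℝ) (hk : k = 1/4 * min 1 (β - 1)) (hk₀ : k₀ = 0)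
    (hs1 : 1/2 < s) (hs2 : s < 1/4 * min 3 (β + 1))
    (hℓ1 : k * ℓ > 2) (hℓ2 : (β - 2*k - 2*s) * ℓ > 2) :
    ∀ C : ℝ, 0 < C → ∃ τ₁ : ℝ, 1 ≤ τ₁ ∧
      ∀ τ₀ : ℝ, τ₁ ≤ τ₀ → ∀ h : ℝ, 0 < h → h ≤ 1 →
        ∀ τ a : ℝ, τ = τ₀ → a = τ₀ ^ ℓ →
          ∀ r : ℝ, 0 < r → r ≠ a →
            Afun k k₀ s τ a r
              - C * (((r + 1) ^ (-β) * mu k k₀ s a r + p r * muDeriv k k₀ s a r)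
                + (mu k k₀ s a r * phiDeriv2 k τ a r) ^ 2
                  / (h⁻¹ * phiDeriv k τ a r * mu k k₀ s a r + muDeriv k k₀ s a r))
            ≥ -(E/2) * muDeriv k k₀ s a r := by
  intro C hC
  subst hk₀
  have hk0 : 0 < k := by
    rw [hk]
    have : 0 < min 1 (β - 1) := lt_min one_pos (by linarith)
    linarith
  have hk4 : 4 * k ≤ 1 := by linarith [min_le_left 1 (β - 1)]
  have hkβ : 4 * k ≤ β - 1 := by linarith [min_le_right 1 (β - 1)]
  have hℓ : 0 < ℓ := pos_of_mul_pos_right (by linarith : 0 < k * ℓ) hk0.le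
  have hℓ_one : 1 ≤ ℓ := by nlinarith
  have hδ : 0 < β - 2 * k - 2 * s := pos_of_mul_pos_left (by linarith) hℓ.le
  obtain ⟨R₀, hR₀⟩ := eventually_atTop.1
    (hp_lim.eventually (gt_mem_nhds (show (0 : ℝ) < E / (4 * C) by positivity)))
  set R := max R₀ 0 with hR
  have hR0 : 0 ≤ R := le_max_right _ _
  have hpR : ∀ r, R ≤ r → C * p r ≤ E / 4 := fun r hr => by
    have := (hR₀ r ((le_max_left _ _).trans hr)).le
    rw [le_div_iff₀ (by positivity)] at this
    linarith
  set M := C * p 0 * (((R + 1) ^ (-k)) ^ 4)⁻¹ with hM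
  have hlim (c : ℝ) {x : ℝ} (hx : 0 < x) {ε : ℝ} (hε : 0 < ε) :
      ∀ᶠ τ : ℝ in atTop, c * τ ^ (-x) ≤ ε := by
    have := (tendsto_rpow_neg_atTop hx).const_mul c
    rw [mul_zero] at this
    exact (this.eventually (gt_mem_nhds hε)).mono fun _ h => h.le
  have hsq : ∀ᶠ τ : ℝ in atTop, C / (2 * k) + M + C * k * τ ≤ τ ^ 2 := by
    filter_upwards [eventually_ge_atTop (C * k + |C / (2 * k) + M|), eventually_ge_atTop 1]
      with τ h1 h2
    nlinarith [le_abs_self (C / (2 * k) + M), abs_nonneg (C / (2 * k) + M)]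
  obtain ⟨τ₁, hτ₁⟩ := eventually_atTop.1
    (((eventually_ge_atTop (1 : ℝ)).and (eventually_ge_atTop R)).and
      (hsq.and ((hlim (2 + C) (x := k * ℓ - 2) (by linarith) (ε := E / 4) (by positivity)).and
        (hlim C (x := ℓ * (β - 2 * k - 2 * s)) (by positivity)
          (ε := E / 4 * (2 * s - 1)) (mul_pos (by positivity) (by linarith))))))
  refine ⟨max 1 τ₁, le_max_left _ _, ?_⟩
  rintro τ₀ hτ₀ h hh hh1 τ a rfl rfl r hr hra
  obtain ⟨⟨hτ1, hτR⟩, hτM, hτc, hτs⟩ := hτ₁ τ ((le_max_right _ _).trans hτ₀)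
  have hτ : 0 < τ := by linarith
  have haτ : τ ≤ τ ^ ℓ := by
    simpa using Real.rpow_le_rpow_of_exponent_le hτ1 hℓ_one
  set a := τ ^ ℓ with ha
  have hx : 0 < r + 1 := by linarith
  rcases lt_or_gt_of_ne hra with hlt | hgt
  · have hy0 : 0 < (r + 1) ^ (-k) := Real.rpow_pos_of_pos hx _
    have e4 : ((r + 1) ^ (-k)) ^ 4 = (r + 1) ^ (-(4 * k)) := by
      rw [← Real.rpow_natCast, ← Real.rpow_mul hx.le]
      push_cast
      ring_nf
    have e2 : (r + 1) ^ (2 * k) = (((r + 1) ^ (-k)) ^ 2)⁻¹ := by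
      rw [← Real.rpow_natCast, ← Real.rpow_mul hx.le, ← Real.rpow_neg hx.le]
      push_cast
      ring_nf
    have e3 : (r + 1) ^ (2 * k - 1) = (r + 1)⁻¹ / ((r + 1) ^ (-k)) ^ 2 := by
      rw [Real.rpow_sub_one hx.ne', e2]
      ring
    have e1 : (r + 1) ^ (-k - 1) = (r + 1) ^ (-k) * (r + 1)⁻¹ := by
      rw [Real.rpow_sub_one hx.ne']
      ring
    have key := lower_bound_of_phase_active (k := k) (τ := τ) (y := (r + 1) ^ (-k))
      (c := (a + 1) ^ (-k)) (q := (r + 1)⁻¹) (h := h) (w := (r + 1) ^ (-β)) (P := p r) (C := C)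
      (E := E) (M := M) hk0 hτ (Real.rpow_pos_of_pos (by linarith) _)
      (Real.rpow_lt_rpow_of_neg hx (by linarith) (by linarith))
      (Real.rpow_lt_one_of_one_lt_of_neg (by linarith) (by linarith)) (by positivity)
      (by
        rw [e4, ← Real.rpow_neg_one]
        exact Real.rpow_le_rpow_of_exponent_le (by linarith) (by linarith)) hh hh1
      (by
        rw [e4, ← Real.rpow_neg_one, ← Real.rpow_add hx]
        exact Real.rpow_le_rpow_of_exponent_le (by linarith) (by linarith)) hC
      (by
        rcases le_total R r with hRr | hRr
        · have : 0 ≤ M * ((r + 1) ^ (-k)) ^ 4 := by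
            have := hp_pos 0 le_rfl
            positivity
          linarith [hpR r hRr]
        · have h1 : C * p r ≤ C * p 0 * 1 := by
            rw [mul_one]
            exact mul_le_mul_of_nonneg_left (hp_mono 0 r le_rfl hr.le) hC.le
          have h2 : (R + 1) ^ (-k) ≤ (r + 1) ^ (-k) :=
            Real.rpow_le_rpow_of_nonpos hx (by linarith) (by linarith)
          have h0 : 0 < (R + 1) ^ (-k) := Real.rpow_pos_of_pos (by linarith) _
          have h3 : 1 ≤ (((R + 1) ^ (-k)) ^ 4)⁻¹ * ((r + 1) ^ (-k)) ^ 4 := by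
            rw [inv_mul_eq_div, one_le_div (by positivity)]
            gcongr
          have h4 := mul_le_mul_of_nonneg_left h3 (mul_pos hC (hp_pos 0 le_rfl)).le
          rw [hM, mul_assoc]
          linarith)
      (by
        refine le_trans ?_ hτc
        gcongr
        calc τ ^ 2 * (a + 1) ^ (-k) ≤ τ ^ 2 * a ^ (-k) :=
              mul_le_mul_of_nonneg_left (Real.rpow_le_rpow_of_nonpos (by linarith)
                (by linarith) (by linarith)) (sq_nonneg τ)
          _ = τ ^ (-(k * ℓ - 2)) := by
            rw [ha, ← Real.rpow_mul hτ.le, ← Real.rpow_natCast, ← Real.rpow_add hτ]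
            push_cast
            ring_nf) hτM
    simpa only [Afun, mu, muDeriv, phiDeriv, phiDeriv2, if_pos hlt, if_pos hlt.le, mul_zero,
      zero_mul, sub_zero, Real.rpow_zero, e1, e2, e3] using key
  · have hmu := rpow_mul_mu_le (β := β) (k := k) (s := s) hk0 hs1 hδ (by linarith : 0 < a) hgt
    have hpr := hpR r (by linarith)
    rw [ha, ← Real.rpow_mul hτ.le, mul_neg, ← ha] at hmu
    have hX : 0 < (r + 1) ^ (-(2 * s)) := Real.rpow_pos_of_pos hx _
    have h1 := mul_le_mul_of_nonneg_left hmu hC.le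
    have h2 := mul_le_mul_of_nonneg_right hτs hX.le
    have h3 := mul_le_mul_of_nonneg_right hpr (mul_pos (by linarith : 0 < 2 * s - 1) hX).le
    simp only [Afun, muDeriv, phiDeriv, phiDeriv2, if_neg (not_lt.2 hgt.le),
      if_neg (not_le.2 hgt)]
    simp only [mul_zero, zero_pow two_ne_zero, zero_div, add_zero]
    linarith
end

section
/- Let E > 0, 0 < α < 1, and let p : [0,∞) → (0,∞) be nonincreasing with p(r) → 0 as r → ∞. Set k = 1 and k₀ = 1/2, fix s with 1/2 < s < 3/4 and ℓ > 2 with (2 − 2s)ℓ > 2. For τ₀ ≥ 1 and 0 < h ≤ 1 put θ = h^{2/(α+3)}, τ = τ₀ θ^{2α/3} h^{−1/3} and a = τ₀^ℓ h^{−2}, let μ, φ, A be as in the context, and define B₁(r) = θ^{α−1}(r+1)^{−4} μ(r) + (p(r) + (r+1)^{−4}) μ′(r) and B₂(r) = (μ(r)(h^{−1}θ^{α}(r+1)^{−4} + |φ″(r)|))² / (h^{−1}φ′(r)μ(r) + μ′(r)). Then for every constant C > 0 there exists τ₁ ≥ 1, depending only on C, E, α, p, s, ℓ, such that for all τ₀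 ≥ τ₁, all 0 < h ≤ 1 and all r > 0 with r ≠ a: A(r) − C(B₁(r) + B₂(r)) ≥ −(E/2) μ′(r). -/
open Filter

/-- Absorbing `u / x` into a multiple of `x` and a multiple of `(u / x) ^ 2`. -/
lemma mul_inv_le_add_of_one_le_cube_mul {η u x : ℝ} (hη : 0 < η) (hu : 1 ≤ η ^ 3 * u)
    (hx : 1 ≤ x) : u * x⁻¹ ≤ η * x + η * (u ^ 2 * (x⁻¹) ^ 2) := by
  have hx0 : 0 < x := by linarith
  have hu0 : 0 < u := pos_of_mul_pos_right (by linarith : 0 < η ^ 3 * u) (by positivity)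
  rcases le_or_gt x (η * u) with hxu | hxu
  · have h1 : u * x⁻¹ = x * (u * (x⁻¹) ^ 2) := by field_simp
    have h2 : x * (u * (x⁻¹) ^ 2) ≤ (η * u) * (u * (x⁻¹) ^ 2) := by gcongr
    have h3 : 0 ≤ η * x := by positivity
    nlinarith
  · have h1 : u ≤ η * x * x := by
      have h2 : η * u * u ≤ x * u := by gcongr
      have h3 : 1 ≤ η ^ 2 * x := by nlinarith [mul_lt_mul_of_pos_left hxu (pow_pos hη 2)]
      have h4 : η * u ≤ η * (η * x * x) := by nlinarith
      exact le_of_mul_le_mul_left h4 hη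
    have h2 : u * x⁻¹ ≤ η * x * x * x⁻¹ := by gcongr
    rw [mul_inv_cancel_right₀ hx0.ne'] at h2
    have h3 : 0 ≤ η * (u ^ 2 * (x⁻¹) ^ 2) := by positivity
    linarith

lemma weighted_phase_deriv_lower_bound {x b τ : ℝ} (hx : 1 ≤ x) (hb : x ≤ b) :
    τ ^ 2 * (x⁻¹) ^ 2 - 3 * (τ ^ 2 * b⁻¹) ≤
      (2 * x - 1) * (τ * (x⁻¹ - b⁻¹)) ^ 2
        + 2 * (x ^ 2 - x) * (τ * (x⁻¹ - b⁻¹)) * (-τ * (x⁻¹) ^ 2) := by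
  have hx0 : 0 < x := by linarith
  have hb0 : 0 < b := by linarith
  have hv : b⁻¹ ≤ 1 := inv_le_one_of_one_le₀ (by linarith)
  have hv0 : 0 < b⁻¹ := by positivity
  have key : (2 * x - 1) * (τ * (x⁻¹ - b⁻¹)) ^ 2
        + 2 * (x ^ 2 - x) * (τ * (x⁻¹ - b⁻¹)) * (-τ * (x⁻¹) ^ 2)
      = τ ^ 2 * ((x⁻¹) ^ 2 - (b⁻¹) ^ 2 - 2 * b⁻¹ + 2 * x * (b⁻¹) ^ 2) := by
    field_simp
    ring
  rw [key]
  have h1 : (x⁻¹) ^ 2 - 3 * b⁻¹ ≤ (x⁻¹) ^ 2 - (b⁻¹) ^ 2 - 2 * b⁻¹ + 2 * x * (b⁻¹) ^ 2 := by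
    have : 0 ≤ 2 * x * (b⁻¹) ^ 2 := by positivity
    nlinarith
  nlinarith [mul_le_mul_of_nonneg_left h1 (sq_nonneg τ)]

lemma quotient_bound_of_two_mul_le {x b h t τ q : ℝ} (hx : 1 < x) (hb : 2 * x ≤ b) (hh : 0 < h)
    (ht : 0 < t) (hτ : 0 < τ) (hq : τ ^ 3 * h = t ^ 3 * q ^ 2) :
    ((x ^ 2 - x) * (h⁻¹ * q * (x⁻¹) ^ 4 + τ * (x⁻¹) ^ 2)) ^ 2
        / (h⁻¹ * (τ * (x⁻¹ - b⁻¹)) * (x ^ 2 - x) + (2 * x - 1))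
      ≤ 4 * (τ ^ 2 * (x⁻¹) ^ 2 * (t⁻¹) ^ 3 + h * τ * x⁻¹) := by
  have hx0 : 0 < x := by linarith
  have hμ : 0 < x ^ 2 - x := by nlinarith
  have hdiff : x⁻¹ / 2 ≤ x⁻¹ - b⁻¹ := by
    have h1 : b⁻¹ ≤ (2 * x)⁻¹ := inv_anti₀ (by positivity) hb
    rw [mul_inv] at h1
    linarith
  have hD : h⁻¹ * (τ * (x⁻¹ / 2)) * (x ^ 2 - x)
      ≤ h⁻¹ * (τ * (x⁻¹ - b⁻¹)) * (x ^ 2 - x) + (2 * x - 1) := by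
    have : h⁻¹ * (τ * (x⁻¹ / 2)) * (x ^ 2 - x) ≤ h⁻¹ * (τ * (x⁻¹ - b⁻¹)) * (x ^ 2 - x) := by
      gcongr
    linarith
  have hD0 : 0 < h⁻¹ * (τ * (x⁻¹ / 2)) * (x ^ 2 - x) := by positivity
  rw [div_le_iff₀ (hD0.trans_le hD)]
  refine le_trans ?_ (mul_le_mul_of_nonneg_left hD (by positivity))
  have hqe : q ^ 2 * (h⁻¹) ^ 2 = h⁻¹ * τ ^ 3 * (t⁻¹) ^ 3 := by
    field_simp
    linarith
  have hP : (h⁻¹ * q * (x⁻¹) ^ 4 + τ * (x⁻¹) ^ 2) ^ 2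
      ≤ 2 * (q ^ 2 * (h⁻¹) ^ 2 * (x⁻¹) ^ 8 + τ ^ 2 * (x⁻¹) ^ 4) := by
    nlinarith [sq_nonneg (h⁻¹ * q * (x⁻¹) ^ 4 - τ * (x⁻¹) ^ 2)]
  rw [hqe] at hP
  have hy : x⁻¹ ≤ 1 := inv_le_one_of_one_le₀ hx.le
  have hmain : (x ^ 2 - x) * (h⁻¹ * q * (x⁻¹) ^ 4 + τ * (x⁻¹) ^ 2) ^ 2
      ≤ 4 * (τ ^ 2 * (x⁻¹) ^ 2 * (t⁻¹) ^ 3 + h * τ * x⁻¹) * (h⁻¹ * (τ * (x⁻¹ / 2))) := by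
    calc _ ≤ x ^ 2 * (2 * (h⁻¹ * τ ^ 3 * (t⁻¹) ^ 3 * (x⁻¹) ^ 8 + τ ^ 2 * (x⁻¹) ^ 4)) := by
            gcongr
            linarith
      _ = 2 * (h⁻¹ * τ ^ 3 * (t⁻¹) ^ 3 * (x⁻¹) ^ 6 + τ ^ 2 * (x⁻¹) ^ 2) := by
            field_simp
      _ ≤ 2 * (h⁻¹ * τ ^ 3 * (t⁻¹) ^ 3 * (x⁻¹) ^ 3 + τ ^ 2 * (x⁻¹) ^ 2) := by
            have : (x⁻¹) ^ 6 ≤ (x⁻¹) ^ 3 := pow_le_pow_of_le_one (by positivity) hy (by norm_num)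
            gcongr
      _ = _ := by
            field_simp
            ring
  nlinarith [mul_le_mul_of_nonneg_left hmain hμ.le]

lemma quotient_bound_of_le_two_mul {x b h τ q e : ℝ} (hx : 1 < x) (hb : x ≤ b) (hb2 : b ≤ 2 * x)
    (hh : 0 < h) (hτ : 0 < τ) (hq0 : 0 < q) (hq1 : q ≤ 1)
    (he1 : τ ^ 2 * b⁻¹ ≤ e) (he2 : (h⁻¹) ^ 2 * b⁻¹ ≤ e) :
    ((x ^ 2 - x) * (h⁻¹ * q * (x⁻¹) ^ 4 + τ * (x⁻¹) ^ 2)) ^ 2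
        / (h⁻¹ * (τ * (x⁻¹ - b⁻¹)) * (x ^ 2 - x) + (2 * x - 1))
      ≤ 8 * e * (2 * x - 1) := by
  have hx0 : 0 < x := by linarith
  have hμ : 0 < x ^ 2 - x := by nlinarith
  have hdiff : 0 ≤ x⁻¹ - b⁻¹ := sub_nonneg.2 (inv_anti₀ hx0 hb)
  have hb0 : 0 < b := by linarith
  have he0 : 0 ≤ e := le_trans (by positivity) he1
  have hD : x ≤ h⁻¹ * (τ * (x⁻¹ - b⁻¹)) * (x ^ 2 - x) + (2 * x - 1) := by
    have : 0 ≤ h⁻¹ * (τ * (x⁻¹ - b⁻¹)) * (x ^ 2 - x) := by positivity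
    linarith
  rw [div_le_iff₀ (hx0.trans_le hD)]
  have hxb : x⁻¹ ≤ 2 * b⁻¹ := by
    have h1 : (2 * x)⁻¹ ≤ b⁻¹ := inv_anti₀ hb0 hb2
    rw [mul_inv] at h1
    linarith
  have hy : x⁻¹ ≤ 1 := inv_le_one_of_one_le₀ hx.le
  have hP : (h⁻¹ * q * (x⁻¹) ^ 4 + τ * (x⁻¹) ^ 2) ^ 2
      ≤ 2 * (q ^ 2 * (h⁻¹) ^ 2 * (x⁻¹) ^ 8 + τ ^ 2 * (x⁻¹) ^ 4) := by
    nlinarith [sq_nonneg (h⁻¹ * q * (x⁻¹) ^ 4 - τ * (x⁻¹) ^ 2)]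
  calc ((x ^ 2 - x) * (h⁻¹ * q * (x⁻¹) ^ 4 + τ * (x⁻¹) ^ 2)) ^ 2
      = (x ^ 2 - x) ^ 2 * (h⁻¹ * q * (x⁻¹) ^ 4 + τ * (x⁻¹) ^ 2) ^ 2 := by ring
    _ ≤ (x ^ 2) ^ 2 * (2 * (1 ^ 2 * (h⁻¹) ^ 2 * (x⁻¹) ^ 5 + τ ^ 2 * (x⁻¹) ^ 4 * x⁻¹ * x)) := by
        have h8 : (x⁻¹) ^ 8 ≤ (x⁻¹) ^ 5 := pow_le_pow_of_le_one (by positivity) hy (by norm_num)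
        have h4 : τ ^ 2 * (x⁻¹) ^ 4 * x⁻¹ * x = τ ^ 2 * (x⁻¹) ^ 4 := by field_simp
        have h2 : x ^ 2 - x ≤ x ^ 2 := by linarith
        rw [h4]
        refine mul_le_mul (pow_le_pow_left₀ hμ.le h2 2) (hP.trans ?_) (by positivity)
          (by positivity)
        gcongr
    _ = 2 * ((h⁻¹) ^ 2 * x⁻¹ + x * (τ ^ 2 * x⁻¹)) := by
        field_simp
    _ ≤ 2 * (x * x * (2 * e) + x * (x * (2 * e))) := by
        have h1 : (h⁻¹) ^ 2 * x⁻¹ ≤ 2 * e := by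
          calc _ ≤ (h⁻¹) ^ 2 * (2 * b⁻¹) := by gcongr
            _ ≤ _ := by linarith
        have h2 : τ ^ 2 * x⁻¹ ≤ 2 * e := by
          calc _ ≤ τ ^ 2 * (2 * b⁻¹) := by gcongr
            _ ≤ _ := by linarith
        have h3 : 1 * (2 * e) ≤ x * x * (2 * e) := by gcongr; nlinarith
        have h4 : 1 * (2 * e) ≤ x * (2 * e) := by gcongr
        have h5 : x * (τ ^ 2 * x⁻¹) ≤ x * (x * (2 * e)) :=
          mul_le_mul_of_nonneg_left (by linarith) hx0.le
        linarith
    _ = 8 * e * (x * x) := by ring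
    _ ≤ 8 * e * ((2 * x - 1) * x) := by gcongr; linarith
    _ ≤ _ := by
        rw [mul_assoc (8 * e)]
        gcongr
        linarith

/-- The part of the estimate inside the ball `r < a`, where `x = r + 1` and `b = a + 1`. -/
lemma inner_bound {C c η M P x b h t τ q w : ℝ} (hC : 0 < C) (hη : 0 < η)
    (hηC : 10 * C * η ≤ 1) (hηc : (3 + 13 * C) * η ≤ c)
    (hMt : M ≤ η * t ^ 2) (ht : 1 ≤ t) (htη : 1 ≤ η * t) (htη3 : 1 ≤ η ^ 3 * t)
    (hx : 1 < x) (hb : x ≤ b) (hh : 0 < h) (hτ : 0 < τ) (hq0 : 0 < q) (hq1 : q ≤ 1)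
    (hw1 : 1 ≤ w) (hτ2 : τ ^ 2 = t ^ 2 * w) (hτ3 : τ ^ 3 * h = t ^ 3 * q ^ 2)
    (hhτ : h * τ ≤ t) (he1 : τ ^ 2 * b⁻¹ ≤ η) (he2 : (h⁻¹) ^ 2 * b⁻¹ ≤ η)
    (hP : P * (2 * x - 1) ≤ η * (2 * x - 1) + M * (x⁻¹) ^ 2) :
    -c * (2 * x - 1) ≤ (2 * x - 1) * (τ * (x⁻¹ - b⁻¹)) ^ 2
        + 2 * (x ^ 2 - x) * (τ * (x⁻¹ - b⁻¹)) * (-τ * (x⁻¹) ^ 2)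
      - C * ((w * (x⁻¹) ^ 4 * (x ^ 2 - x) + P * (2 * x - 1))
        + ((x ^ 2 - x) * (h⁻¹ * q * (x⁻¹) ^ 4 + τ * (x⁻¹) ^ 2)) ^ 2
        / (h⁻¹ * (τ * (x⁻¹ - b⁻¹)) * (x ^ 2 - x) + (2 * x - 1))) := by
  have hx0 : 0 < x := by linarith
  have ht0 : 0 < t := by linarith
  have hA := weighted_phase_deriv_lower_bound (τ := τ) hx.le hb
  obtain ⟨T, hT⟩ : ∃ T, T = τ ^ 2 * (x⁻¹) ^ 2 := ⟨_, rfl⟩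
  have hT0 : 0 ≤ T := by rw [hT]; positivity
  have hm : x ≤ 2 * x - 1 := by linarith
  have hwT : t ^ 2 * (x⁻¹) ^ 2 ≤ T := by
    rw [hT, hτ2]
    have : t ^ 2 * 1 ≤ t ^ 2 * w := by gcongr
    gcongr
    linarith
  have hti : t⁻¹ ≤ η := by
    rw [inv_le_iff_one_le_mul₀ ht0]
    exact htη
  have hti1 : t⁻¹ ≤ 1 := inv_le_one_of_one_le₀ ht
  have hti3 : (t⁻¹) ^ 3 ≤ η := by
    calc (t⁻¹) ^ 3 ≤ (t⁻¹) ^ 1 := pow_le_pow_of_le_one (by positivity) hti1 (by norm_num)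
      _ ≤ η := by simpa using hti
  have hti2 : (t⁻¹) ^ 2 ≤ η := by
    calc (t⁻¹) ^ 2 ≤ (t⁻¹) ^ 1 := pow_le_pow_of_le_one (by positivity) hti1 (by norm_num)
      _ ≤ η := by simpa using hti
  have hB1 : w * (x⁻¹) ^ 4 * (x ^ 2 - x) ≤ η * T := by
    calc w * (x⁻¹) ^ 4 * (x ^ 2 - x) ≤ w * (x⁻¹) ^ 4 * x ^ 2 := by gcongr; linarith
      _ = (t⁻¹) ^ 2 * T := by
          rw [hT, hτ2]
          field_simp
      _ ≤ _ := by gcongr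
  have hMT : M * (x⁻¹) ^ 2 ≤ η * T := by
    calc M * (x⁻¹) ^ 2 ≤ η * t ^ 2 * (x⁻¹) ^ 2 := by gcongr
      _ = η * (t ^ 2 * (x⁻¹) ^ 2) := by ring
      _ ≤ _ := by gcongr
  have hB2 : ((x ^ 2 - x) * (h⁻¹ * q * (x⁻¹) ^ 4 + τ * (x⁻¹) ^ 2)) ^ 2
        / (h⁻¹ * (τ * (x⁻¹ - b⁻¹)) * (x ^ 2 - x) + (2 * x - 1))
      ≤ 12 * η * (2 * x - 1) + 8 * η * T := by
    have hηT : 0 ≤ η * T := by positivity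
    have hηm : 0 ≤ η * (2 * x - 1) := by nlinarith
    rcases le_total (2 * x) b with hxb | hxb
    · refine (quotient_bound_of_two_mul_le hx hxb hh ht0 hτ hτ3).trans ?_
      rw [← hT]
      have h1 : T * (t⁻¹) ^ 3 ≤ T * η := by gcongr
      have h2 : h * τ * x⁻¹ ≤ t * x⁻¹ := by gcongr
      have h3 := mul_inv_le_add_of_one_le_cube_mul hη htη3 hx.le
      have h4 : η * x ≤ η * (2 * x - 1) := by gcongr
      have h5 : η * (t ^ 2 * (x⁻¹) ^ 2) ≤ η * T := by gcongr
      linarith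
    · refine (quotient_bound_of_le_two_mul hx hb hxb hh hτ hq0 hq1 he1 he2).trans ?_
      linarith
  have hsum := mul_le_mul_of_nonneg_left (add_le_add (add_le_add hB1 hP) hB2) hC.le
  have hm1 : η * 1 ≤ η * (2 * x - 1) := by gcongr; linarith
  have hCT := mul_le_mul_of_nonneg_right hηC hT0
  have hcm := mul_le_mul_of_nonneg_right hηc (by linarith : 0 ≤ 2 * x - 1)
  have hCM := mul_le_mul_of_nonneg_left hMT hC.le
  rw [← hT] at hA
  linarith

/-- The part of the estimate outside the ball, where `x = r + 1`, `b = a + 1` and `m` is the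
value of the weight. -/
lemma outer_bound {C c η P s x b h t q w m : ℝ} (hC : 0 < C) (hη1 : η ≤ 1)
    (hηc : (3 + 13 * C) * η ≤ c) (hs1 : 1 / 2 < s) (hs2 : s < 1) (ht : 1 ≤ t)
    (hts : 1 ≤ η * (2 * s - 1) * t) (hb : 1 ≤ b) (hx : b ≤ x) (hh : 0 < h)
    (hq0 : 0 < q) (hq1 : q ≤ 1) (hw : w ≤ h⁻¹) (hm0 : 0 ≤ m) (hm : m ≤ b ^ 2)
    (hG : h⁻¹ * b ^ (2 * s - 2) ≤ (t⁻¹) ^ 2) (hP : P ≤ 2 * η) :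
    -c * ((2 * s - 1) * x ^ (-(2 * s))) ≤
      -(C * ((w * (x⁻¹) ^ 4 * m + P * ((2 * s - 1) * x ^ (-(2 * s))))
        + (m * (h⁻¹ * q * (x⁻¹) ^ 4)) ^ 2 / ((2 * s - 1) * x ^ (-(2 * s))))) := by
  have ht0 : 0 < t := by linarith
  have hb0 : 0 < b := by linarith
  have hx0 : 0 < x := by linarith
  have hσ : 0 < 2 * s - 1 := by linarith
  obtain ⟨y, hy⟩ : ∃ y, y = x ^ (-(2 * s)) := ⟨_, rfl⟩
  have hy0 : 0 < y := by rw [hy]; positivity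
  have hη : 0 < η := by
    have h1 : 0 < η * ((2 * s - 1) * t) := by linarith
    exact pos_of_mul_pos_left h1 (by positivity)
  have hti : (t⁻¹) ^ 2 ≤ η * (2 * s - 1) := by
    have hti1 : t⁻¹ ≤ 1 := inv_le_one_of_one_le₀ ht
    calc (t⁻¹) ^ 2 ≤ (t⁻¹) ^ 1 := pow_le_pow_of_le_one (by positivity) hti1 (by norm_num)
      _ ≤ _ := by
        rw [pow_one, inv_le_iff_one_le_mul₀ ht0]
        exact hts
  have hcore : h⁻¹ * ((x⁻¹) ^ 4 * m) ≤ η * (2 * s - 1) * y := by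
    have hx4 : (x⁻¹) ^ 4 = x ^ (2 * s - 4) * y := by
      rw [hy, ← Real.rpow_add hx0, inv_pow, ← Real.rpow_natCast, ← Real.rpow_neg hx0.le]
      congr 1
      push_cast
      ring
    have hb2 : b ^ (2 * s - 2) = b ^ (2 * s - 4) * b ^ 2 := by
      rw [← Real.rpow_natCast, ← Real.rpow_add hb0]
      congr 1
      push_cast
      ring
    have hxb : x ^ (2 * s - 4) ≤ b ^ (2 * s - 4) :=
      Real.rpow_le_rpow_of_nonpos hb0 hx (by linarith)
    calc h⁻¹ * ((x⁻¹) ^ 4 * m) = h⁻¹ * (x ^ (2 * s - 4) * y * m) := by rw [hx4]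
      _ ≤ h⁻¹ * (b ^ (2 * s - 4) * y * b ^ 2) := by gcongr
      _ = h⁻¹ * b ^ (2 * s - 2) * y := by rw [hb2]; ring
      _ ≤ η * (2 * s - 1) * y := mul_le_mul_of_nonneg_right (hG.trans hti) hy0.le
  have h1 : w * (x⁻¹) ^ 4 * m ≤ η * ((2 * s - 1) * y) := by
    calc w * (x⁻¹) ^ 4 * m ≤ h⁻¹ * (x⁻¹) ^ 4 * m := by gcongr
      _ = h⁻¹ * ((x⁻¹) ^ 4 * m) := by ring
      _ ≤ _ := by linarith
  have h2 : (m * (h⁻¹ * q * (x⁻¹) ^ 4)) ^ 2 / ((2 * s - 1) * y) ≤ η * ((2 * s - 1) * y) := by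
    rw [div_le_iff₀ (by positivity)]
    have h3 : m * (h⁻¹ * q * (x⁻¹) ^ 4) ≤ η * ((2 * s - 1) * y) := by
      calc m * (h⁻¹ * q * (x⁻¹) ^ 4) = (h⁻¹ * ((x⁻¹) ^ 4 * m)) * q := by ring
        _ ≤ (h⁻¹ * ((x⁻¹) ^ 4 * m)) * 1 := by gcongr
        _ ≤ _ := by linarith
    calc _ ≤ (η * ((2 * s - 1) * y)) ^ 2 := by gcongr
      _ = η * (η * (((2 * s - 1) * y) * ((2 * s - 1) * y))) := by ring
      _ ≤ 1 * (η * (((2 * s - 1) * y) * ((2 * s - 1) * y))) := by gcongr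
      _ = _ := by ring
  rw [← hy]
  have hz : 0 < (2 * s - 1) * y := by positivity
  have h3 := mul_le_mul_of_nonneg_right hP hz.le
  have hsum := mul_le_mul_of_nonneg_left (add_le_add (add_le_add h1 h3) h2) hC.le
  have hcm := mul_le_mul_of_nonneg_right hηc hz.le
  have h4 : 0 ≤ η * ((2 * s - 1) * y) := by positivity
  have h5 : 0 ≤ C * (η * ((2 * s - 1) * y)) := by positivity
  linarith

/-- A function on `[0, ∞)` that decreases to `0` contributes a small multiple of the weight plus
a multiple of `(r + 1) ^ (-2)`. -/
lemma exists_decay_bound {p : ℝ → ℝ} (hp_pos : ∀ r : ℝ, 0 ≤ r → 0 < p r)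
    (hp_mono : ∀ r r' : ℝ, 0 ≤ r → r ≤ r' → p r' ≤ p r) (hp_lim : Tendsto p atTop (nhds 0))
    {η : ℝ} (hη : 0 < η) :
    ∃ M : ℝ, ∀ r : ℝ, 0 < r →
      (p r + ((r + 1)⁻¹) ^ 4) * (2 * (r + 1) - 1)
        ≤ η * (2 * (r + 1) - 1) + M * ((r + 1)⁻¹) ^ 2 := by
  have hlim : Tendsto (fun r : ℝ => p r + ((r + 1)⁻¹) ^ 4) atTop (nhds 0) := by
    have h1 : Tendsto (fun r : ℝ => (r + 1)⁻¹) atTop (nhds 0) :=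
      tendsto_inv_atTop_zero.comp (tendsto_atTop_add_const_right _ _ tendsto_id)
    simpa using hp_lim.add (h1.pow 4)
  obtain ⟨R, hR⟩ :=
    ((hlim.eventually (gt_mem_nhds hη)).and (eventually_ge_atTop 0)).exists_forall_of_atTop
  have hR0 : 0 ≤ R := (hR R le_rfl).2
  have hp0 := hp_pos 0 le_rfl
  refine ⟨(p 0 + 1) * (2 * (R + 1)) * (R + 1) ^ 2, fun r hr => ?_⟩
  have hx0 : 0 < r + 1 := by linarith
  rcases le_total R r with hRr | hRr
  · have h1 := (hR r hRr).1.le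
    have h2 : 0 ≤ (p 0 + 1) * (2 * (R + 1)) * (R + 1) ^ 2 * ((r + 1)⁻¹) ^ 2 := by positivity
    have h3 := mul_le_mul_of_nonneg_right h1 (by linarith : 0 ≤ 2 * (r + 1) - 1)
    linarith
  · have h1 := hp_mono 0 r le_rfl hr.le
    have h2 : ((r + 1)⁻¹) ^ 4 ≤ 1 :=
      pow_le_one₀ (by positivity) (inv_le_one_of_one_le₀ (by linarith))
    have h3 : 0 ≤ η * (2 * (r + 1) - 1) := by
      have : 0 < 2 * (r + 1) - 1 := by linarith
      positivity
    have hone : 1 ≤ (R + 1) ^ 2 * ((r + 1)⁻¹) ^ 2 := by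
      rw [← mul_pow]
      refine one_le_pow₀ ?_
      rw [← div_eq_mul_inv, one_le_div hx0]
      linarith
    have h4 : (p r + ((r + 1)⁻¹) ^ 4) * (2 * (r + 1) - 1) ≤ (p 0 + 1) * (2 * (R + 1)) := by
      have : 0 ≤ 2 * (r + 1) - 1 := by linarith
      gcongr
      linarith
    have h5 : (p 0 + 1) * (2 * (R + 1)) * 1
        ≤ (p 0 + 1) * (2 * (R + 1)) * ((R + 1) ^ 2 * ((r + 1)⁻¹) ^ 2) := by gcongr
    linarith

lemma tau_pos_sq_cube {α h t θ τ : ℝ} (hα : 0 < α) (hh : 0 < h) (ht : 0 < t)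
    (hθ : θ = h ^ (2 / (α + 3))) (hτ : τ = t * θ ^ (2 * α / 3) * h ^ (-(1 / 3) : ℝ)) :
    0 < τ ∧ τ ^ 2 = t ^ 2 * θ ^ (α - 1) ∧ τ ^ 3 * h = t ^ 3 * (θ ^ α) ^ 2 := by
  have hα3 : α + 3 ≠ 0 := by linarith
  have hτ' : τ = t * h ^ ((α - 1) / (α + 3)) := by
    rw [hτ, hθ, ← Real.rpow_mul hh.le, mul_assoc, ← Real.rpow_add hh]
    congr 2
    field_simp
    ring
  refine ⟨by rw [hτ']; positivity, ?_, ?_⟩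
  · rw [hτ', hθ, ← Real.rpow_mul hh.le, mul_pow, ← Real.rpow_natCast (h ^ _),
      ← Real.rpow_mul hh.le]
    congr 2
    push_cast
    ring
  · rw [hτ', hθ, ← Real.rpow_mul hh.le, mul_pow, ← Real.rpow_natCast (h ^ _),
      ← Real.rpow_natCast (h ^ _), ← Real.rpow_mul hh.le, ← Real.rpow_mul hh.le, mul_assoc]
    nth_rw 2 [← Real.rpow_one h]
    rw [← Real.rpow_add hh]
    congr 2
    push_cast
    field_simp
    ring

lemma theta_bounds {α h θ : ℝ} (hα : 0 < α) (hα1 : α < 1) (hh : 0 < h) (hh1 : h ≤ 1)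
    (hθ : θ = h ^ (2 / (α + 3))) :
    0 < θ ^ α ∧ θ ^ α ≤ 1 ∧ 1 ≤ θ ^ (α - 1) ∧ θ ^ (α - 1) ≤ h⁻¹ := by
  have hθ0 : 0 < θ := by rw [hθ]; positivity
  have hθ1 : θ ≤ 1 := by
    rw [hθ]
    exact Real.rpow_le_one hh.le hh1 (by positivity)
  refine ⟨by positivity, Real.rpow_le_one hθ0.le hθ1 hα.le,
    Real.one_le_rpow_of_pos_of_le_one_of_nonpos hθ0 hθ1 (by linarith), ?_⟩
  rw [hθ, ← Real.rpow_mul hh.le, ← Real.rpow_neg_one]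
  refine Real.rpow_le_rpow_of_exponent_ge hh hh1 ?_
  rw [div_mul_eq_mul_div, le_div_iff₀ (by linarith)]
  linarith

lemma inv_mul_radius_rpow_le {h t s ℓ a : ℝ} (hh : 0 < h) (hh1 : h ≤ 1) (ht : 1 ≤ t)
    (hs : s < 3 / 4) (hℓ : 2 < (2 - 2 * s) * ℓ) (ha : a = t ^ ℓ * h ^ (-(2 : ℝ))) :
    h⁻¹ * (a + 1) ^ (2 * s - 2) ≤ (t⁻¹) ^ 2 := by
  have ht0 : 0 < t := by linarith
  have ha0 : 0 < a := by rw [ha]; positivity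
  have h1 : (a + 1) ^ (2 * s - 2) ≤ a ^ (2 * s - 2) :=
    Real.rpow_le_rpow_of_nonpos ha0 (by linarith) (by linarith)
  have h2 : h⁻¹ * a ^ (2 * s - 2) = t ^ (-((2 - 2 * s) * ℓ)) * h ^ (3 - 4 * s) := by
    rw [ha, Real.mul_rpow (by positivity) (by positivity), ← Real.rpow_mul ht0.le,
      ← Real.rpow_mul hh.le, ← Real.rpow_neg_one, mul_left_comm, ← Real.rpow_add hh]
    congr 2 <;> ring
  calc h⁻¹ * (a + 1) ^ (2 * s - 2) ≤ h⁻¹ * a ^ (2 * s - 2) := by gcongr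
    _ = t ^ (-((2 - 2 * s) * ℓ)) * h ^ (3 - 4 * s) := h2
    _ ≤ t ^ (-((2 - 2 * s) * ℓ)) * 1 := by
        gcongr
        exact Real.rpow_le_one hh.le hh1 (by linarith)
    _ ≤ t ^ (-(2 : ℝ)) := by
        rw [mul_one]
        exact Real.rpow_le_rpow_of_exponent_le ht (by linarith)
    _ = (t⁻¹) ^ 2 := by
        rw [Real.rpow_neg ht0.le, inv_pow]
        norm_num

lemma radius_bounds {h t ℓ a τ w : ℝ} (hh : 0 < h) (hh1 : h ≤ 1) (ht : 1 ≤ t) (hℓ : 2 < ℓ)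
    (ha : a = t ^ ℓ * h ^ (-(2 : ℝ))) (hw : w ≤ h⁻¹) (hτ2 : τ ^ 2 = t ^ 2 * w) :
    t ≤ a ∧ τ ^ 2 * (a + 1)⁻¹ ≤ t ^ (2 - ℓ) ∧ (h⁻¹) ^ 2 * (a + 1)⁻¹ ≤ t ^ (2 - ℓ) := by
  have ht0 : 0 < t := by linarith
  have hh2 : h ^ (-(2 : ℝ)) = (h⁻¹) ^ 2 := by
    rw [Real.rpow_neg hh.le, inv_pow]
    norm_num
  rw [hh2] at ha
  have hi1 : 1 ≤ h⁻¹ := (one_le_inv₀ hh).2 hh1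
  have htl : t ≤ t ^ ℓ := by
    simpa using Real.rpow_le_rpow_of_exponent_le ht (by linarith : (1 : ℝ) ≤ ℓ)
  have hta : t ≤ a := by
    rw [ha]
    have : t ^ ℓ * 1 ≤ t ^ ℓ * (h⁻¹) ^ 2 := by
      gcongr
      exact one_le_pow₀ hi1
    linarith
  have ha1 : 0 < a + 1 := by linarith
  have hprod : t ^ (2 - ℓ) * t ^ ℓ = t ^ 2 := by
    rw [← Real.rpow_add ht0]
    norm_num
  have hkey : t ^ 2 * (h⁻¹) ^ 2 ≤ t ^ (2 - ℓ) * (a + 1) := by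
    have : t ^ (2 - ℓ) * a = t ^ 2 * (h⁻¹) ^ 2 := by rw [ha, ← mul_assoc, hprod]
    have h0 : 0 < t ^ (2 - ℓ) := by positivity
    linarith
  refine ⟨hta, ?_, ?_⟩
  · rw [← div_eq_mul_inv, div_le_iff₀ ha1, hτ2]
    refine le_trans ?_ hkey
    gcongr
    nlinarith
  · rw [← div_eq_mul_inv, div_le_iff₀ ha1]
    refine le_trans ?_ hkey
    have : 1 * (h⁻¹) ^ 2 ≤ t ^ 2 * (h⁻¹) ^ 2 := by
      gcongr
      exact one_le_pow₀ ht
    linarith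


/-- Lemma 2.3 in the Hölder case (potential satisfying (1.8), β = 4), with
k = 1, k₀ = 1/2. -/
theorem stmt_8 (E α : ℝ) (hE : 0 < E) (hα : 0 < α) (hα1 : α < 1)
    (p : ℝ → ℝ) (hp_pos : ∀ r : ℝ, 0 ≤ r → 0 < p r)
    (hp_mono : ∀ r r' : ℝ, 0 ≤ r → r ≤ r' → p r' ≤ p r)
    (hp_lim : Filter.Tendsto p Filter.atTop (nhds 0))
    (k k₀ s ℓ : ℝ) (hk : k = 1) (hk₀ : k₀ = 1/2)
    (hs1 : 1/2 < s) (hs2 : s < 3/4)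
    (hℓ1 : 2 < ℓ) (hℓ2 : (2 - 2*s) * ℓ > 2) :
    ∀ C : ℝ, 0 < C → ∃ τ₁ : ℝ, 1 ≤ τ₁ ∧
      ∀ τ₀ : ℝ, τ₁ ≤ τ₀ → ∀ h : ℝ, 0 < h → h ≤ 1 →
        ∀ θ τ a : ℝ, θ = h ^ (2/(α+3)) → τ = τ₀ * θ ^ (2*α/3) * h ^ (-(1/3) : ℝ) →
          a = τ₀ ^ ℓ * h ^ (-(2:ℝ)) →
          ∀ r : ℝ, 0 < r → r ≠ a →
            Afun k k₀ s τ a r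
              - C * ((θ ^ (α - 1) * (r + 1) ^ (-(4:ℝ)) * mu k k₀ s a r
                    + (p r + (r + 1) ^ (-(4:ℝ))) * muDeriv k k₀ s a r)
                + (mu k k₀ s a r * (h⁻¹ * θ ^ α * (r + 1) ^ (-(4:ℝ)) + |phiDeriv2 k τ a r|)) ^ 2
                  / (h⁻¹ * phiDeriv k τ a r * mu k k₀ s a r + muDeriv k k₀ s a r))
            ≥ -(E/2) * muDeriv k k₀ s a r := by
  intro C hC
  subst hk hk₀
  obtain ⟨η, hη, hη1, hηC, hηc⟩ : ∃ η : ℝ, 0 < η ∧ η ≤ 1 ∧ 10 * C * η ≤ 1 ∧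
      (3 + 13 * C) * η ≤ E / 2 := by
    refine ⟨min 1 (min (1 / (10 * C)) (E / 2 / (3 + 13 * C))), by positivity,
      min_le_left _ _, ?_, ?_⟩
    · rw [← le_div_iff₀' (by positivity)]
      exact (min_le_right _ _).trans (min_le_left _ _)
    · rw [← le_div_iff₀' (by positivity)]
      exact (min_le_right _ _).trans (min_le_right _ _)
  obtain ⟨M, hM⟩ := exists_decay_bound hp_pos hp_mono hp_lim hη
  have hσ : 0 < 2 * s - 1 := by linarith
  have hrpow : Tendsto (fun t : ℝ => t ^ (2 - ℓ)) atTop (nhds 0) := by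
    simpa using tendsto_rpow_neg_atTop (by linarith : 0 < ℓ - 2)
  have hlarge : ∀ᶠ t : ℝ in atTop, 1 ≤ t ∧ M ≤ η * t ^ 2 ∧ 1 ≤ η ^ 3 * t ∧
      1 ≤ η * (2 * s - 1) * t ∧ t ^ (2 - ℓ) ≤ η ∧ p t ≤ η :=
    (eventually_ge_atTop 1).and <|
      (((tendsto_pow_atTop two_ne_zero).const_mul_atTop hη).eventually_ge_atTop M).and <|
      ((tendsto_id.const_mul_atTop (pow_pos hη 3)).eventually_ge_atTop 1).and <|
      ((tendsto_id.const_mul_atTop (mul_pos hη hσ)).eventually_ge_atTop 1).and <|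
      (hrpow.eventually (ge_mem_nhds hη)).and (hp_lim.eventually (ge_mem_nhds hη))
  obtain ⟨τ₁, hτ₁⟩ := hlarge.exists_forall_of_atTop
  refine ⟨τ₁, (hτ₁ τ₁ le_rfl).1, fun t htτ h hh hh1 θ τ a hθ hτ ha r hr hra => ?_⟩
  obtain ⟨ht, hMt, htη3, hts, htℓ, hpt⟩ := hτ₁ t htτ
  have ht0 : 0 < t := by linarith
  obtain ⟨hτ0, hτ2, hτ3⟩ := tau_pos_sq_cube hα hh ht0 hθ hτ
  obtain ⟨hq0, hq1, hw1, hw⟩ := theta_bounds hα hα1 hh hh1 hθ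
  obtain ⟨hta, he1, he2⟩ := radius_bounds hh hh1 ht hℓ1 ha hw hτ2
  have hx0 : 0 < r + 1 := by linarith
  have hb0 : 0 < a + 1 := by linarith
  have hx4 : (r + 1) ^ (-(4 : ℝ)) = ((r + 1)⁻¹) ^ 4 := by
    rw [Real.rpow_neg hx0.le, inv_pow]
    norm_num
  have hηt : 1 ≤ η * t := by
    have : η ^ 3 * t ≤ η ^ 1 * t := by
      gcongr ?_ * t
      exact pow_le_pow_of_le_one hη.le hη1 (by norm_num)
    linarith
  rw [hx4, ge_iff_le]
  rcases lt_or_gt_of_ne hra with hlt | hgt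
  · have hmu : mu 1 (1 / 2) s a r = (r + 1) ^ 2 - (r + 1) := by
      norm_num [mu, hlt.le]
    have hmu' : muDeriv 1 (1 / 2) s a r = 2 * (r + 1) - 1 := by
      norm_num [muDeriv, hlt]
    have hphi : phiDeriv 1 τ a r = τ * ((r + 1)⁻¹ - (a + 1)⁻¹) := by
      simp only [phiDeriv, hlt.le, if_true, Real.rpow_neg_one]
    have hphi2 : phiDeriv2 1 τ a r = -τ * ((r + 1)⁻¹) ^ 2 := by
      have : (r + 1) ^ (-1 - 1 : ℝ) = ((r + 1)⁻¹) ^ 2 := by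
        rw [show (-1 - 1 : ℝ) = -2 by norm_num, Real.rpow_neg hx0.le, inv_pow]
        norm_num
      simp only [phiDeriv2, hlt, if_true, one_mul, this]
    have habs : |-τ * ((r + 1)⁻¹) ^ 2| = τ * ((r + 1)⁻¹) ^ 2 := by
      rw [neg_mul, abs_neg, abs_of_nonneg (by positivity)]
    rw [Afun, hmu, hmu', hphi, hphi2, habs]
    have hhτ : h * τ ≤ t := by
      refine le_of_sq_le_sq ?_ ht0.le
      have h1 : h * θ ^ (α - 1) ≤ 1 := by
        calc h * θ ^ (α - 1) ≤ h * h⁻¹ := by gcongr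
          _ = 1 := mul_inv_cancel₀ hh.ne'
      have h2 : h * (h * θ ^ (α - 1)) ≤ 1 := mul_le_one₀ hh1 (by positivity) h1
      calc (h * τ) ^ 2 = t ^ 2 * (h * (h * θ ^ (α - 1))) := by rw [mul_pow, hτ2]; ring
        _ ≤ t ^ 2 * 1 := by gcongr
        _ = t ^ 2 := mul_one _
    exact inner_bound hC hη hηC hηc hMt ht hηt htη3 (by linarith) (by linarith) hh hτ0
      hq0 hq1 hw1 hτ2 hτ3 hhτ (he1.trans htℓ) (he2.trans htℓ) (hM r hr)
  · have hmu' : muDeriv 1 (1 / 2) s a r = (2 * s - 1) * (r + 1) ^ (-(2 * s)) := by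
      simp only [muDeriv, not_lt.2 hgt.le, if_false]
    have hphi : phiDeriv 1 τ a r = 0 := by simp only [phiDeriv, not_le.2 hgt, if_false]
    have hphi2 : phiDeriv2 1 τ a r = 0 := by simp only [phiDeriv2, not_lt.2 hgt.le, if_false]
    have hmu : mu 1 (1 / 2) s a r =
        (a + 1) ^ 2 - (a + 1) + (a + 1) ^ (1 - 2 * s) - (r + 1) ^ (1 - 2 * s) := by
      norm_num [mu, not_le.2 hgt]
    have hm0 : 0 ≤ mu 1 (1 / 2) s a r := by
      have h1 : (r + 1) ^ (1 - 2 * s) ≤ (a + 1) ^ (1 - 2 * s) :=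
        Real.rpow_le_rpow_of_nonpos hb0 (by linarith) (by linarith)
      rw [hmu]
      nlinarith
    have hm : mu 1 (1 / 2) s a r ≤ (a + 1) ^ 2 := by
      have h1 : (a + 1) ^ (1 - 2 * s) ≤ 1 :=
        Real.rpow_le_one_of_one_le_of_nonpos (by linarith) (by linarith)
      have h2 : 0 < (r + 1) ^ (1 - 2 * s) := by positivity
      rw [hmu]
      linarith
    have hP : p r + ((r + 1)⁻¹) ^ 4 ≤ 2 * η := by
      have h1 := hp_mono t r ht0.le (by linarith)
      have h2 : (r + 1)⁻¹ ≤ η := by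
        rw [inv_le_iff_one_le_mul₀ hx0]
        have : η * t ≤ η * (r + 1) := by gcongr; linarith
        linarith
      have h3 : ((r + 1)⁻¹) ^ 4 ≤ ((r + 1)⁻¹) ^ 1 :=
        pow_le_pow_of_le_one (by positivity) (inv_le_one_of_one_le₀ (by linarith)) (by norm_num)
      rw [pow_one] at h3
      linarith
    have := outer_bound hC hη1 hηc hs1 (by linarith) ht hts (by linarith : 1 ≤ a + 1)
      (by linarith : a + 1 ≤ r + 1) hh hq0 hq1 hw hm0 hm
      (inv_mul_radius_rpow_le hh hh1 ht hs2 hℓ2 ha) hP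
    rw [Afun, hmu', hphi, hphi2]
    simpa using this
end

section
/- Let E > 0, 0 < α < 1, and let p : [0,∞) → (0,∞) be nonincreasing with p(r) → 0 as r → ∞. Set k = 1 and k₀ = 1/2, fix s with 1/2 < s < 3/4 and ℓ > 2 with (2 − 2s)ℓ > 2. For τ₀ ≥ 1 and 0 < h ≤ 1 put θ = h^{2/(α+3)}, τ = τ₀ θ^{2α/3} h^{−1/3} and a = τ₀^ℓ h^{−2}, let μ, φ, A be as in the context, and define B₁(r) = θ^{α−1}(r+1)^{−4} μ(r) + (p(r) + (r+1)^{−4}) μ′(r) and B₂(r) = (μ(r)(h^{−1}θ^{α}(r+1)^{−4} + |φ″(r)|))² / (h^{−1}φ′(r)μ(r) + μ′(r)). Then for all constants C > 0 and r₀ > 0 there exists τ₁ ≥ 1, depending only on C, E, r₀, α, p, s, ℓ, such that for every τ₀ ≥ τ₁ there exists h₀ ∈ (0,1), depending on E, r₀ and τ₀, such that for all 0 < h ≤ h₀ and all r ≥ r₀ with r ≠ a: A(r) − h² r^{−3} μ(r) − C(B₁(r) + B₂(r)) ≥ −(2E/3) μ′(r). -/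
open Filter Topology

lemma mu_of_le {s a r : ℝ} (hr : r ≤ a) :
    mu 1 (1 / 2) s a r = (r + 1) ^ 2 - (r + 1) := by
  rw [mu, if_pos hr]
  norm_num

lemma mu_of_gt {s a r : ℝ} (hr : a < r) :
    mu 1 (1 / 2) s a r
      = (a + 1) ^ 2 - (a + 1) + (a + 1) ^ (1 - 2 * s) - (r + 1) ^ (1 - 2 * s) := by
  rw [mu, if_neg hr.not_ge]
  norm_num

lemma muDeriv_of_lt {s a r : ℝ} (hr : r < a) :
    muDeriv 1 (1 / 2) s a r = 2 * (r + 1) - 1 := by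
  rw [muDeriv, if_pos hr]
  norm_num

lemma muDeriv_of_gt {s a r : ℝ} (hr : a < r) :
    muDeriv 1 (1 / 2) s a r = (2 * s - 1) * (r + 1) ^ (-(2 * s)) := by
  rw [muDeriv, if_neg hr.not_gt]

lemma phiDeriv_of_le {τ a r : ℝ} (hr : r ≤ a) :
    phiDeriv 1 τ a r = τ * ((r + 1)⁻¹ - (a + 1)⁻¹) := by
  rw [phiDeriv, if_pos hr, Real.rpow_neg_one, Real.rpow_neg_one]

lemma phiDeriv2_of_lt {τ a r : ℝ} (h0 : 0 ≤ r + 1) (hr : r < a) :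
    phiDeriv2 1 τ a r = -(τ * ((r + 1) ^ 2)⁻¹) := by
  rw [phiDeriv2, if_pos hr, show (-1 - 1 : ℝ) = -2 by norm_num, Real.rpow_neg h0, Real.rpow_two]
  ring

/-- Lower bound for `(μ φ'²)'` in the region `r < a`, with `x = r + 1` and `b = a + 1`. -/
lemma inner_deriv_lower_bound {x b τ : ℝ} (hx : 1 ≤ x) (hxb : x < b) :
    τ ^ 2 * (x ^ 2)⁻¹ - 2 * (τ ^ 2 / b) * (2 * x - 1) ≤
      (2 * x - 1) * (τ * (x⁻¹ - b⁻¹)) ^ 2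
        + 2 * (x ^ 2 - x) * (τ * (x⁻¹ - b⁻¹)) * -(τ * (x ^ 2)⁻¹) := by
  have hx0 : 0 < x := by linarith
  have hb0 : 0 < b := by linarith
  have hv : 0 < b⁻¹ := by positivity
  have huv : b⁻¹ ≤ x⁻¹ := inv_anti₀ hx0 hxb.le
  have hu : x⁻¹ ≤ 1 := inv_le_one_of_one_le₀ hx
  have hA : (2 * x - 1) * (τ * (x⁻¹ - b⁻¹)) ^ 2
        + 2 * (x ^ 2 - x) * (τ * (x⁻¹ - b⁻¹)) * -(τ * (x ^ 2)⁻¹)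
      = τ ^ 2 * ((x ^ 2)⁻¹ - b⁻¹ * (x⁻¹ + (x⁻¹ - b⁻¹) * (2 * x - 1))) := by
    field_simp
    ring
  rw [hA]
  have h1 : x⁻¹ + (x⁻¹ - b⁻¹) * (2 * x - 1) ≤ 2 * (2 * x - 1) := by nlinarith
  have h2 := mul_le_mul_of_nonneg_left h1 hv.le
  have h3 := mul_le_mul_of_nonneg_left h2 (sq_nonneg τ)
  rw [div_eq_mul_inv]
  linarith

lemma inner_quotient_bound {x b τ h q : ℝ} (hx : 1 < x) (hxb : x < b) (hτ : 0 < τ)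
    (hh : 0 < h) (hb : (h ^ 2)⁻¹ ≤ b) :
    ((x ^ 2 - x) * (h⁻¹ * q * (x ^ 4)⁻¹ + τ * (x ^ 2)⁻¹)) ^ 2
        / (h⁻¹ * (τ * (x⁻¹ - b⁻¹)) * (x ^ 2 - x) + (2 * x - 1)) ≤
      4 * (h⁻¹ * q ^ 2 / τ) * (x ^ 2)⁻¹
        + (4 * (h * τ) + 4 * q ^ 2 + 4 * (τ ^ 2 / b)) * (2 * x - 1) := by
  have hx0 : 0 < x := by linarith
  have hb0 : 0 < b := by linarith
  have hm : 0 < x ^ 2 - x := by nlinarith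
  have hmx : x ^ 2 - x ≤ x ^ 2 := by linarith
  have huv : b⁻¹ < x⁻¹ := inv_strictAnti₀ hx0 hxb
  have hS : (h⁻¹ * q * (x ^ 4)⁻¹ + τ * (x ^ 2)⁻¹) ^ 2
      ≤ 2 * (h⁻¹ * q * (x ^ 4)⁻¹) ^ 2 + 2 * (τ * (x ^ 2)⁻¹) ^ 2 := by
    nlinarith [sq_nonneg (h⁻¹ * q * (x ^ 4)⁻¹ - τ * (x ^ 2)⁻¹)]
  set S := (h⁻¹ * q * (x ^ 4)⁻¹ + τ * (x ^ 2)⁻¹) ^ 2 with hSdef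
  have hS0 : 0 ≤ S := sq_nonneg _
  have hxinv : x⁻¹ ≤ 1 := inv_le_one_of_one_le₀ hx.le
  have hε : 0 ≤ τ ^ 2 / b := by positivity
  have hhτ : 0 < h * τ := by positivity
  have hphi : 0 < h⁻¹ * (τ * (x⁻¹ - b⁻¹)) * (x ^ 2 - x) :=
    mul_pos (mul_pos (by positivity) (mul_pos hτ (by linarith))) hm
  rw [mul_pow, ← hSdef]
  rcases le_or_gt (2 * x) b with hcase | hcase
  · have hhalf : b⁻¹ ≤ (2 * x)⁻¹ := inv_anti₀ (by positivity) hcase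
    have hD : h⁻¹ * (τ * (2 * x)⁻¹) * (x ^ 2 - x)
        ≤ h⁻¹ * (τ * (x⁻¹ - b⁻¹)) * (x ^ 2 - x) + (2 * x - 1) := by
      have h1 : (2 * x)⁻¹ ≤ x⁻¹ - b⁻¹ := by
        have : x⁻¹ = 2 * (2 * x)⁻¹ := by field_simp
        linarith
      have h2 : h⁻¹ * (τ * (2 * x)⁻¹) * (x ^ 2 - x)
          ≤ h⁻¹ * (τ * (x⁻¹ - b⁻¹)) * (x ^ 2 - x) := by gcongr
      linarith
    calc (x ^ 2 - x) ^ 2 * S / (h⁻¹ * (τ * (x⁻¹ - b⁻¹)) * (x ^ 2 - x) + (2 * x - 1))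
        ≤ (x ^ 2 - x) ^ 2 * S / (h⁻¹ * (τ * (2 * x)⁻¹) * (x ^ 2 - x)) :=
          div_le_div_of_nonneg_left (by positivity) (by positivity) hD
      _ = 2 * h / τ * x * ((x ^ 2 - x) * S) := by field_simp
      _ ≤ 2 * h / τ * x * (x ^ 2 *
            (2 * (h⁻¹ * q * (x ^ 4)⁻¹) ^ 2 + 2 * (τ * (x ^ 2)⁻¹) ^ 2)) := by gcongr
      _ = 4 * (h⁻¹ * q ^ 2 / τ) * (x ^ 2)⁻¹ * (x⁻¹) ^ 3 + 4 * (h * τ) * x⁻¹ := by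
          field_simp
          ring
      _ ≤ 4 * (h⁻¹ * q ^ 2 / τ) * (x ^ 2)⁻¹ * 1 + 4 * (h * τ) * 1 := by
          gcongr
          exact pow_le_one₀ (by positivity) hxinv
      _ ≤ _ := by nlinarith [sq_nonneg q]
  · have hxb2 : x⁻¹ ≤ 2 * b⁻¹ := by
      rw [show 2 * b⁻¹ = (b / 2)⁻¹ by field_simp]
      exact inv_anti₀ (by positivity) (by linarith)
    have hhb : (h⁻¹) ^ 2 * b⁻¹ ≤ 1 := by
      rw [inv_pow, ← div_eq_mul_inv, div_le_one hb0]
      exact hb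
    have hD : x ≤ h⁻¹ * (τ * (x⁻¹ - b⁻¹)) * (x ^ 2 - x) + (2 * x - 1) := by linarith
    calc (x ^ 2 - x) ^ 2 * S / (h⁻¹ * (τ * (x⁻¹ - b⁻¹)) * (x ^ 2 - x) + (2 * x - 1))
        ≤ (x ^ 2 - x) ^ 2 * S / x := div_le_div_of_nonneg_left (by positivity) hx0 hD
      _ ≤ (x ^ 2) ^ 2 *
            (2 * (h⁻¹ * q * (x ^ 4)⁻¹) ^ 2 + 2 * (τ * (x ^ 2)⁻¹) ^ 2) / x := by gcongr
      _ = 2 * (h⁻¹) ^ 2 * q ^ 2 * (x⁻¹ * (x⁻¹) ^ 4) + 2 * τ ^ 2 * x⁻¹ := by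
          field_simp
      _ ≤ 2 * (h⁻¹) ^ 2 * q ^ 2 * (2 * b⁻¹ * 1) + 2 * τ ^ 2 * (2 * b⁻¹) := by
          gcongr
          exact pow_le_one₀ (by positivity) hxinv
      _ = 4 * q ^ 2 * ((h⁻¹) ^ 2 * b⁻¹) + 4 * (τ ^ 2 / b) := by ring
      _ ≤ 4 * q ^ 2 * 1 + 4 * (τ ^ 2 / b) := by gcongr
      _ ≤ _ := by
          have : 0 ≤ 4 * (h⁻¹ * q ^ 2 / τ) * (x ^ 2)⁻¹ := by positivity
          nlinarith [sq_nonneg q]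

lemma rpow_neg_three_halves_le {x s : ℝ} (hx : 1 ≤ x) (hs : s < 3 / 4) :
    ((√x) ^ 3)⁻¹ ≤ x ^ (-(2 * s)) := by
  have hx0 : 0 ≤ x := by linarith
  have : ((√x) ^ 3)⁻¹ = x ^ (-(3 / 2) : ℝ) := by
    rw [Real.rpow_neg hx0, Real.sqrt_eq_rpow, ← Real.rpow_natCast, ← Real.rpow_mul hx0]
    norm_num
  rw [this]
  exact Real.rpow_le_rpow_of_exponent_le hx (by linarith)

lemma outer_quartic_bound {x b h s : ℝ} (hb1 : 1 ≤ b) (hbx : b ≤ x) (hh : 0 < h)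
    (hb : (h ^ 2)⁻¹ ≤ b) (hs : s < 3 / 4) :
    b ^ 2 * (x ^ 4)⁻¹ ≤ h * x ^ (-(2 * s)) := by
  refine le_trans ?_ (mul_le_mul_of_nonneg_left
    (rpow_neg_three_halves_le (hb1.trans hbx) hs) hh.le)
  have hx0 : 0 < x := by linarith
  obtain ⟨y, hy, rfl⟩ : ∃ y : ℝ, 0 < y ∧ x = y ^ 2 :=
    ⟨√x, Real.sqrt_pos.2 hx0, (Real.sq_sqrt hx0.le).symm⟩
  rw [Real.sqrt_sq hy.le, ← div_eq_mul_inv, ← div_eq_mul_inv, div_le_div_iff₀ (by positivity)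
    (by positivity)]
  have h1 : 1 ≤ h * y := by
    have h2 : h⁻¹ ≤ y := by
      rw [← inv_pow] at hb
      exact le_of_sq_le_sq (hb.trans hbx) hy.le
    calc (1 : ℝ) = h * h⁻¹ := by field_simp
      _ ≤ h * y := by gcongr
  calc b ^ 2 * y ^ 3 ≤ (y ^ 2) ^ 2 * y ^ 3 * 1 := by rw [mul_one]; gcongr
    _ ≤ (y ^ 2) ^ 2 * y ^ 3 * (h * y) := by gcongr
    _ = h * (y ^ 2) ^ 4 := by ring

lemma outer_cubic_bound {x b s : ℝ} (hb1 : 1 ≤ b) (hbx : b ≤ x) (hs : s < 3 / 4) :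
    b ^ 2 * (x ^ 3)⁻¹ ≤ √b * x ^ (-(2 * s)) := by
  refine le_trans ?_ (mul_le_mul_of_nonneg_left
    (rpow_neg_three_halves_le (hb1.trans hbx) hs) (Real.sqrt_nonneg b))
  have hx0 : 0 < x := by linarith
  have hb0 : 0 < b := by linarith
  have hc : √b ≤ √x := Real.sqrt_le_sqrt hbx
  have hc0 : 0 < √b := Real.sqrt_pos.2 hb0
  have hy0 : 0 < √x := Real.sqrt_pos.2 hx0
  have hb' : b = √b ^ 2 := (Real.sq_sqrt hb0.le).symm
  have hx' : x = √x ^ 2 := (Real.sq_sqrt hx0.le).symm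
  generalize √b = c at *
  generalize √x = y at *
  subst hb' hx'
  rw [← div_eq_mul_inv, ← div_eq_mul_inv, div_le_div_iff₀ (by positivity) (by positivity)]
  calc (c ^ 2) ^ 2 * y ^ 3 = c * c ^ 3 * y ^ 3 := by ring
    _ ≤ c * y ^ 3 * y ^ 3 := by gcongr
    _ = c * (y ^ 2) ^ 3 := by ring

lemma eventually_mul_rpow_le (c : ℝ) {e δ : ℝ} (he : 0 < e) (hδ : 0 < δ) :
    ∀ᶠ h in 𝓝[>] (0 : ℝ), c * h ^ e ≤ δ := by
  have h1 : Tendsto (fun h : ℝ => c * h ^ e) (𝓝[>] 0) (𝓝 0) := by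
    have := ((Real.continuousAt_rpow_const 0 e (Or.inr he.le)).tendsto.const_mul c)
    rw [Real.zero_rpow he.ne', mul_zero] at this
    exact this.mono_left nhdsWithin_le_nhds
  exact h1.eventually_le_const hδ

lemma inner_estimate {r b τ h q w C E r₀ P δ : ℝ} (hr₀ : 0 < r₀) (hr : r₀ ≤ r)
    (hrb : r + 1 < b) (hτ : 0 < τ) (hh : 0 < h) (hb : (h ^ 2)⁻¹ ≤ b) (hC : 0 < C) (hE : 0 < E)
    (hw : 0 ≤ w) (hT₁ : 3 * C * w ≤ τ ^ 2) (hT₂ : 12 * C * (h⁻¹ * q ^ 2 / τ) ≤ τ ^ 2)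
    (hP : C * (P + ((r + 1) ^ 4)⁻¹) * (2 * (r + 1) - 1)
      ≤ E / 12 * (2 * (r + 1) - 1) + τ ^ 2 / 3 * ((r + 1) ^ 2)⁻¹)
    (hδ : 100 * (C + 1) * δ ≤ E) (hh₀ : h ^ 2 ≤ δ * r₀ ^ 2) (hhτ : h * τ ≤ δ)
    (hq : q ^ 2 ≤ δ) (hτb : τ ^ 2 / b ≤ δ) :
    -(2 * E / 3) * (2 * (r + 1) - 1) ≤
      (2 * (r + 1) - 1) * (τ * ((r + 1)⁻¹ - b⁻¹)) ^ 2
        + 2 * ((r + 1) ^ 2 - (r + 1)) * (τ * ((r + 1)⁻¹ - b⁻¹)) * -(τ * ((r + 1) ^ 2)⁻¹)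
        - h ^ 2 * (r ^ 3)⁻¹ * ((r + 1) ^ 2 - (r + 1))
        - C * ((w * ((r + 1) ^ 4)⁻¹ * ((r + 1) ^ 2 - (r + 1))
            + (P + ((r + 1) ^ 4)⁻¹) * (2 * (r + 1) - 1))
          + (((r + 1) ^ 2 - (r + 1)) * (h⁻¹ * q * ((r + 1) ^ 4)⁻¹ + τ * ((r + 1) ^ 2)⁻¹)) ^ 2
            / (h⁻¹ * (τ * ((r + 1)⁻¹ - b⁻¹)) * ((r + 1) ^ 2 - (r + 1))
              + (2 * (r + 1) - 1))) := by
  have hr0 : 0 < r := hr₀.trans_le hr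
  have hA := inner_deriv_lower_bound (x := r + 1) (τ := τ) (by linarith) hrb
  have hB := mul_le_mul_of_nonneg_left
    (inner_quotient_bound (x := r + 1) (q := q) (by linarith) hrb hτ hh hb) hC.le
  have hH : h ^ 2 * (r ^ 3)⁻¹ * ((r + 1) ^ 2 - (r + 1)) ≤ δ * (2 * (r + 1) - 1) := by
    have h1 : h ^ 2 * (r ^ 2)⁻¹ ≤ δ := by
      rw [← div_eq_mul_inv, div_le_iff₀ (by positivity)]
      have hδ0 : 0 ≤ δ := (sq_nonneg q).trans hq
      exact hh₀.trans (by gcongr)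
    calc h ^ 2 * (r ^ 3)⁻¹ * ((r + 1) ^ 2 - (r + 1)) = h ^ 2 * (r ^ 2)⁻¹ * (r + 1) := by
          field_simp
          ring
      _ ≤ δ * (r + 1) := by gcongr
      _ ≤ _ := by nlinarith [sq_nonneg q]
  have hW : C * (w * ((r + 1) ^ 4)⁻¹ * ((r + 1) ^ 2 - (r + 1)))
      ≤ τ ^ 2 / 3 * ((r + 1) ^ 2)⁻¹ := by
    calc C * (w * ((r + 1) ^ 4)⁻¹ * ((r + 1) ^ 2 - (r + 1)))
        ≤ C * (w * ((r + 1) ^ 4)⁻¹ * (r + 1) ^ 2) := by gcongr; linarith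
      _ = C * w * ((r + 1) ^ 2)⁻¹ := by field_simp
      _ ≤ _ := by gcongr; linarith
  have hQ : C * (4 * (h⁻¹ * q ^ 2 / τ) * ((r + 1) ^ 2)⁻¹) ≤ τ ^ 2 / 3 * ((r + 1) ^ 2)⁻¹ := by
    rw [← mul_assoc]
    gcongr
    linarith
  have hsmall : 2 * (τ ^ 2 / b) + δ + C * (4 * (h * τ) + 4 * q ^ 2 + 4 * (τ ^ 2 / b))
      + E / 12 ≤ 2 * E / 3 := by
    have h1 : C * (4 * (h * τ) + 4 * q ^ 2 + 4 * (τ ^ 2 / b)) ≤ C * (12 * δ) := by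
      gcongr
      linarith
    have hδ0 : 0 ≤ δ := (sq_nonneg q).trans hq
    nlinarith [mul_nonneg hC.le hδ0]
  have hsmall' := mul_le_mul_of_nonneg_right hsmall (show 0 ≤ 2 * (r + 1) - 1 by linarith)
  linarith

lemma outer_estimate {r b h q w C E P s m δ : ℝ} (hr1 : 1 ≤ r) (hb1 : 1 ≤ b)
    (hbr : b ≤ r + 1) (hh : 0 < h) (hb : (h ^ 2)⁻¹ ≤ b) (hs1 : 1 / 2 < s) (hs2 : s < 3 / 4)
    (hC : 0 < C) (hE : 0 < E) (hw : 0 ≤ w) (hm0 : 0 ≤ m) (hm : m ≤ b ^ 2)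
    (hP : C * (P + ((r + 1) ^ 4)⁻¹) ≤ E / 12) (hδ : 100 * (C + 1) * δ ≤ E)
    (hhb : h ^ 2 * √b ≤ δ * (2 * s - 1)) (hwh : w * h ≤ δ * (2 * s - 1))
    (hq : q ^ 2 ≤ δ * (2 * s - 1) ^ 2) :
    -(2 * E / 3) * ((2 * s - 1) * (r + 1) ^ (-(2 * s))) ≤
      -(h ^ 2 * (r ^ 3)⁻¹ * m)
        - C * ((w * ((r + 1) ^ 4)⁻¹ * m
            + (P + ((r + 1) ^ 4)⁻¹) * ((2 * s - 1) * (r + 1) ^ (-(2 * s))))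
          + (m * (h⁻¹ * q * ((r + 1) ^ 4)⁻¹)) ^ 2
            / ((2 * s - 1) * (r + 1) ^ (-(2 * s)))) := by
  have h4 := outer_quartic_bound hb1 hbr hh hb hs2
  have h3 := outer_cubic_bound hb1 hbr hs2
  have hX : 0 < (r + 1) ^ (-(2 * s)) := by positivity
  have hγ : 0 < 2 * s - 1 := by linarith
  set X := (r + 1) ^ (-(2 * s))
  set γ := 2 * s - 1
  have h3m : m * (r ^ 3)⁻¹ ≤ 8 * (√b * X) := by
    calc m * (r ^ 3)⁻¹ ≤ b ^ 2 * (((r + 1) / 2) ^ 3)⁻¹ := by gcongr; linarith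
      _ = 8 * (b ^ 2 * ((r + 1) ^ 3)⁻¹) := by field_simp; norm_num
      _ ≤ _ := by gcongr
  have h4m : m * ((r + 1) ^ 4)⁻¹ ≤ h * X := le_trans (by gcongr) h4
  have hH : h ^ 2 * (r ^ 3)⁻¹ * m ≤ 8 * δ * (γ * X) := by
    calc h ^ 2 * (r ^ 3)⁻¹ * m = h ^ 2 * (m * (r ^ 3)⁻¹) := by ring
      _ ≤ h ^ 2 * (8 * (√b * X)) := by gcongr
      _ = 8 * (h ^ 2 * √b) * X := by ring
      _ ≤ 8 * (δ * γ) * X := by gcongr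
      _ = _ := by ring
  have hW : w * ((r + 1) ^ 4)⁻¹ * m ≤ δ * (γ * X) := by
    calc w * ((r + 1) ^ 4)⁻¹ * m = w * (m * ((r + 1) ^ 4)⁻¹) := by ring
      _ ≤ w * (h * X) := by gcongr
      _ = w * h * X := by ring
      _ ≤ δ * γ * X := by gcongr
      _ = _ := by ring
  have hQ : (m * (h⁻¹ * q * ((r + 1) ^ 4)⁻¹)) ^ 2 / (γ * X) ≤ δ * (γ * X) := by
    rw [div_le_iff₀ (by positivity)]
    calc (m * (h⁻¹ * q * ((r + 1) ^ 4)⁻¹)) ^ 2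
        = q ^ 2 * (h⁻¹ * (m * ((r + 1) ^ 4)⁻¹)) ^ 2 := by ring
      _ ≤ q ^ 2 * (h⁻¹ * (h * X)) ^ 2 := by gcongr
      _ = q ^ 2 * X ^ 2 := by field_simp
      _ ≤ δ * γ ^ 2 * X ^ 2 := by gcongr
      _ = _ := by ring
  have hδ0 : 0 ≤ δ := by
    by_contra hneg
    nlinarith [sq_nonneg q, pow_pos hγ 2]
  have hsmall : 8 * δ + C * (2 * δ) + E / 12 ≤ 2 * E / 3 := by
    nlinarith [mul_nonneg hC.le hδ0]
  have hsmall' := mul_le_mul_of_nonneg_right hsmall (mul_pos hγ hX).le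
  have hW' := mul_le_mul_of_nonneg_left hW hC.le
  have hQ' := mul_le_mul_of_nonneg_left hQ hC.le
  have hP' := mul_le_mul_of_nonneg_right hP (mul_pos hγ hX).le
  linarith

/-- The semiclassical parameters as powers of `h`. -/
lemma parameter_identities {α h τ₀ : ℝ} (hα : 0 < α) (hh : 0 < h) :
    let θ := h ^ (2 / (α + 3))
    let τ := τ₀ * θ ^ (2 * α / 3) * h ^ (-(1 / 3) : ℝ)
    τ ^ 2 = τ₀ ^ 2 * θ ^ (α - 1) ∧
      h⁻¹ * (θ ^ α) ^ 2 / τ = θ ^ (α - 1) / τ₀ ∧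
      h * τ = τ₀ * h ^ (2 * (α + 1) / (α + 3)) ∧
      θ ^ (α - 1) * h = h ^ ((3 * α + 1) / (α + 3)) ∧
      (θ ^ α) ^ 2 = h ^ (4 * α / (α + 3)) := by
  intro θ τ
  have hα3 : α + 3 ≠ 0 := by positivity
  have hτ : τ = τ₀ * h ^ ((α - 1) / (α + 3)) := by
    simp only [τ, θ]
    rw [← Real.rpow_mul hh.le, mul_assoc, ← Real.rpow_add hh]
    congr 2
    field_simp
    ring
  have hw : θ ^ (α - 1) = h ^ (2 * (α - 1) / (α + 3)) := by
    simp only [θ]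
    rw [← Real.rpow_mul hh.le]
    congr 1
    ring
  have hq : (θ ^ α) ^ 2 = h ^ (4 * α / (α + 3)) := by
    simp only [θ]
    rw [← Real.rpow_mul hh.le, ← Real.rpow_natCast, ← Real.rpow_mul hh.le]
    congr 1
    push_cast
    ring
  refine ⟨?_, ?_, ?_, ?_, hq⟩
  · rw [hτ, hw, mul_pow, ← Real.rpow_natCast (h ^ _), ← Real.rpow_mul hh.le]
    congr 2
    push_cast
    ring
  · rw [hτ, hw, hq, ← Real.rpow_neg_one, ← Real.rpow_add hh, div_mul_eq_div_div_swap,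
      ← Real.rpow_sub hh]
    congr 2
    field_simp
    ring
  · rw [hτ, mul_left_comm, ← Real.rpow_one_add' hh.le]
    · congr 2
      field_simp
      ring
    · rw [show 1 + (α - 1) / (α + 3) = 2 * (α + 1) / (α + 3) by field_simp; ring]
      positivity
  · rw [hw, ← Real.rpow_add_one hh.ne']
    congr 1
    field_simp
    ring

lemma mu_bounds_of_gt {s a r : ℝ} (hs : 1 / 2 < s) (ha : 0 ≤ a) (hr : a < r) :
    0 ≤ mu 1 (1 / 2) s a r ∧ mu 1 (1 / 2) s a r ≤ (a + 1) ^ 2 := by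
  have hpow : (r + 1) ^ (1 - 2 * s) ≤ (a + 1) ^ (1 - 2 * s) :=
    Real.rpow_le_rpow_of_nonpos (by linarith) (by linarith) (by linarith)
  have hpow1 : (a + 1) ^ (1 - 2 * s) ≤ 1 :=
    Real.rpow_le_one_of_one_le_of_nonpos (by linarith) (by linarith)
  have hpow0 : 0 ≤ (r + 1) ^ (1 - 2 * s) := Real.rpow_nonneg (by linarith) _
  rw [mu_of_gt hr]
  constructor <;> nlinarith

lemma decay_term_bound {p : ℝ → ℝ} {C E R T r : ℝ} (hC : 0 < C) (hE : 0 < E) (hp0 : 0 ≤ p 0)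
    (hp : ∀ r, 0 ≤ r → p r ≤ p 0) (hR : ∀ r, R ≤ r → C * (p r + ((r + 1) ^ 4)⁻¹) ≤ E / 12)
    (hr : 0 < r) (hT : 6 * C * (p 0 + 1) * (R + 1) ^ 3 ≤ T) (hT0 : 0 ≤ T) :
    C * (p r + ((r + 1) ^ 4)⁻¹) * (2 * (r + 1) - 1)
      ≤ E / 12 * (2 * (r + 1) - 1) + T / 3 * ((r + 1) ^ 2)⁻¹ := by
  rcases le_or_gt R r with hRr | hRr
  · have h1 := mul_le_mul_of_nonneg_right (hR r hRr) (show 0 ≤ 2 * (r + 1) - 1 by linarith)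
    have h2 : 0 ≤ T / 3 * ((r + 1) ^ 2)⁻¹ := by positivity
    linarith
  · have h1 : C * (p r + ((r + 1) ^ 4)⁻¹) * (2 * (r + 1) - 1) ≤ T / 3 * ((r + 1) ^ 2)⁻¹ := by
      rw [← div_eq_mul_inv, le_div_iff₀ (by positivity)]
      have h2 : ((r + 1) ^ 4)⁻¹ ≤ 1 := inv_le_one_of_one_le₀ (one_le_pow₀ (by linarith))
      have h3 := hp r hr.le
      have hb : 0 ≤ 2 * (r + 1) - 1 := by linarith
      calc C * (p r + ((r + 1) ^ 4)⁻¹) * (2 * (r + 1) - 1) * (r + 1) ^ 2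
          ≤ C * (p 0 + 1) * (2 * (R + 1)) * (R + 1) ^ 2 := by
            have hR0 : 0 ≤ R := hr.le.trans hRr.le
            gcongr
            linarith
        _ = 6 * C * (p 0 + 1) * (R + 1) ^ 3 / 3 := by ring
        _ ≤ T / 3 := by linarith
    have h4 : 0 ≤ E / 12 * (2 * (r + 1) - 1) := mul_nonneg (by positivity) (by linarith)
    linarith

lemma weighted_estimate {p : ℝ → ℝ} {C E R r₀ τ₀ τ a h q w s δ r : ℝ} (hC : 0 < C) (hE : 0 < E)
    (hs1 : 1 / 2 < s) (hs2 : s < 3 / 4) (hp0 : 0 ≤ p 0) (hp : ∀ r, 0 ≤ r → p r ≤ p 0)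
    (hR : ∀ r, R ≤ r → C * (p r + ((r + 1) ^ 4)⁻¹) ≤ E / 12)
    (hr₀ : 0 < r₀) (hr : r₀ ≤ r) (hra : r ≠ a) (hτ₀1 : 1 ≤ τ₀)
    (hτ₀C : 12 * C ≤ τ₀ ^ 2) (hτ₀R : 6 * C * (p 0 + 1) * (R + 1) ^ 3 ≤ τ₀ ^ 2)
    (hτ : 0 < τ) (hh : 0 < h) (ha1 : 1 ≤ a) (hRa : R ≤ a) (hha : (h ^ 2)⁻¹ ≤ a) (hw : 1 ≤ w)
    (hτsq : τ ^ 2 = τ₀ ^ 2 * w) (hqτ : h⁻¹ * q ^ 2 / τ = w / τ₀)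
    (hδ : 100 * (C + 1) * δ ≤ E) (hh₀ : h ^ 2 ≤ δ * r₀ ^ 2) (hhτ : h * τ ≤ δ)
    (hq : q ^ 2 ≤ δ * (2 * s - 1) ^ 2) (hwh : w * h ≤ δ * (2 * s - 1))
    (hτa : τ ^ 2 / (a + 1) ≤ δ) (hh_sqrt : h ^ 2 * √(a + 1) ≤ δ * (2 * s - 1)) :
    -(2 * E / 3) * muDeriv 1 (1 / 2) s a r ≤
      Afun 1 (1 / 2) s τ a r - h ^ 2 * (r ^ 3)⁻¹ * mu 1 (1 / 2) s a r
        - C * ((w * ((r + 1) ^ 4)⁻¹ * mu 1 (1 / 2) s a r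
            + (p r + ((r + 1) ^ 4)⁻¹) * muDeriv 1 (1 / 2) s a r)
          + (mu 1 (1 / 2) s a r * (h⁻¹ * q * ((r + 1) ^ 4)⁻¹ + |phiDeriv2 1 τ a r|)) ^ 2
            / (h⁻¹ * phiDeriv 1 τ a r * mu 1 (1 / 2) s a r + muDeriv 1 (1 / 2) s a r)) := by
  have hr0 : 0 < r := hr₀.trans_le hr
  have hr1 : 0 ≤ r + 1 := by linarith
  have hw0 : 0 ≤ w := by linarith
  have hδ0 : 0 ≤ δ := le_trans (by positivity) hhτ
  rw [Afun]
  rcases lt_or_gt_of_ne hra with hlt | hgt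
  · have hqδ : q ^ 2 ≤ δ :=
      hq.trans (mul_le_of_le_one_right hδ0 (pow_le_one₀ (by linarith) (by linarith)))
    rw [mu_of_le hlt.le, muDeriv_of_lt hlt, phiDeriv_of_le hlt.le, phiDeriv2_of_lt hr1 hlt,
      abs_neg, abs_of_nonneg (show 0 ≤ τ * ((r + 1) ^ 2)⁻¹ by positivity)]
    refine inner_estimate hr₀ hr (by linarith) hτ hh (by linarith) hC hE hw0 ?_ ?_ ?_
      hδ hh₀ hhτ hqδ hτa
    · rw [hτsq]
      gcongr
      linarith
    · rw [hqτ, hτsq]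
      calc 12 * C * (w / τ₀) ≤ 12 * C * w :=
            mul_le_mul_of_nonneg_left (div_le_self hw0 hτ₀1) (by positivity)
        _ ≤ τ₀ ^ 2 * w := by gcongr
    · refine decay_term_bound hC hE hp0 hp hR hr0 ?_ (sq_nonneg τ)
      rw [hτsq]
      exact hτ₀R.trans (le_mul_of_one_le_right (sq_nonneg τ₀) hw)
  · have hphi : phiDeriv 1 τ a r = 0 := by rw [phiDeriv, if_neg hgt.not_ge]
    have hphi2 : phiDeriv2 1 τ a r = 0 := by rw [phiDeriv2, if_neg hgt.not_gt]
    obtain ⟨hm0, hm⟩ := mu_bounds_of_gt hs1 (by linarith) hgt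
    have key := outer_estimate (by linarith) (show 1 ≤ a + 1 by linarith) (by linarith) hh
      (by linarith) hs1 hs2 hC hE hw0 hm0 hm (hR r (by linarith)) hδ hh_sqrt hwh hq
    rw [muDeriv_of_gt hgt, hphi, hphi2]
    simpa using key

/-- Lemma 2.4 in the Hölder case (potential satisfying (1.8), β = 4), with
k = 1, k₀ = 1/2, valid for 0 < h ≤ h₀. -/
theorem stmt_9 (E α : ℝ) (hE : 0 < E) (hα : 0 < α) (hα1 : α < 1)
    (p : ℝ → ℝ) (hp_pos : ∀ r : ℝ, 0 ≤ r → 0 < p r)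
    (hp_mono : ∀ r r' : ℝ, 0 ≤ r → r ≤ r' → p r' ≤ p r)
    (hp_lim : Filter.Tendsto p Filter.atTop (nhds 0))
    (k k₀ s ℓ : ℝ) (hk : k = 1) (hk₀ : k₀ = 1/2)
    (hs1 : 1/2 < s) (hs2 : s < 3/4)
    (hℓ1 : 2 < ℓ) (hℓ2 : (2 - 2*s) * ℓ > 2) :
    ∀ C r₀ : ℝ, 0 < C → 0 < r₀ → ∃ τ₁ : ℝ, 1 ≤ τ₁ ∧
      ∀ τ₀ : ℝ, τ₁ ≤ τ₀ → ∃ h₀ : ℝ, 0 < h₀ ∧ h₀ < 1 ∧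
        ∀ h : ℝ, 0 < h → h ≤ h₀ →
          ∀ θ τ a : ℝ, θ = h ^ (2/(α+3)) → τ = τ₀ * θ ^ (2*α/3) * h ^ (-(1/3) : ℝ) →
            a = τ₀ ^ ℓ * h ^ (-(2:ℝ)) →
            ∀ r : ℝ, r₀ ≤ r → r ≠ a →
              Afun k k₀ s τ a r - h ^ 2 * r ^ (-(3:ℝ)) * mu k k₀ s a r
                - C * ((θ ^ (α - 1) * (r + 1) ^ (-(4:ℝ)) * mu k k₀ s a r
                      + (p r + (r + 1) ^ (-(4:ℝ))) * muDeriv k k₀ s a r)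
                  + (mu k k₀ s a r * (h⁻¹ * θ ^ α * (r + 1) ^ (-(4:ℝ)) + |phiDeriv2 k τ a r|)) ^ 2
                    / (h⁻¹ * phiDeriv k τ a r * mu k k₀ s a r + muDeriv k k₀ s a r))
              ≥ -(2*E/3) * muDeriv k k₀ s a r := by
  subst hk hk₀
  intro C r₀ hC hr₀
  have hp0 := hp_pos 0 le_rfl
  have hlim : Tendsto (fun r : ℝ => C * (p r + ((r + 1) ^ 4)⁻¹)) atTop (𝓝 0) := by
    have h1 : Tendsto (fun r : ℝ => ((r + 1) ^ 4)⁻¹) atTop (𝓝 0) :=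
      ((tendsto_pow_atTop (by norm_num)).comp
        (tendsto_atTop_add_const_right _ 1 tendsto_id)).inv_tendsto_atTop
    simpa using (hp_lim.add h1).const_mul C
  obtain ⟨R, hR1, hR⟩ : ∃ R : ℝ, 1 ≤ R ∧ ∀ r, R ≤ r → C * (p r + ((r + 1) ^ 4)⁻¹) ≤ E / 12 := by
    obtain ⟨R, hR⟩ := eventually_atTop.1 (hlim.eventually_le_const (show 0 < E / 12 by positivity))
    exact ⟨max R 1, le_max_right _ _, fun r hr => hR r ((le_max_left _ _).trans hr)⟩
  have hM : 0 ≤ 6 * C * (p 0 + 1) * (R + 1) ^ 3 := by positivity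
  refine ⟨1 + 12 * C + 6 * C * (p 0 + 1) * (R + 1) ^ 3, by linarith, fun τ₀ hτ₀ => ?_⟩
  have hτ₀1 : 1 ≤ τ₀ := by linarith
  have hτ₀0 : 0 < τ₀ := by linarith
  have hτ₀sq : τ₀ ≤ τ₀ ^ 2 := by nlinarith
  have hγ : 0 < 2 * s - 1 := by linarith
  have hγ1 : 2 * s - 1 ≤ 1 := by linarith
  obtain ⟨δ, hδ0, hδ⟩ : ∃ δ : ℝ, 0 < δ ∧ 100 * (C + 1) * δ ≤ E :=
    ⟨E / (100 * (C + 1)), by positivity, by field_simp; rfl⟩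
  have hδγ : 0 < δ * (2 * s - 1) := by positivity
  have hδγ2 : 0 < δ * (2 * s - 1) ^ 2 := by positivity
  have hδγ_le : δ * (2 * s - 1) ≤ δ := mul_le_of_le_one_right hδ0.le hγ1
  have ev := (((((eventually_mul_rpow_le 1 (e := 2) two_pos
      (show 0 < δ * r₀ ^ 2 by positivity)).and
    (eventually_mul_rpow_le (2 * τ₀ ^ ℓ) (e := 2) two_pos
      (show 0 < (δ * (2 * s - 1)) ^ 2 by positivity))).and
    (eventually_mul_rpow_le R (e := 2) two_pos one_pos)).and
    (eventually_mul_rpow_le τ₀ (show 0 < 2 * (α + 1) / (α + 3) by positivity) hδ0)).and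
    (eventually_mul_rpow_le 1 (show 0 < (3 * α + 1) / (α + 3) by positivity) hδγ)).and
    (eventually_mul_rpow_le 1 (show 0 < 4 * α / (α + 3) by positivity) hδγ2)
  obtain ⟨h₁, hh₁, hev⟩ := (mem_nhdsGT_iff_exists_Ioc_subset).1 ev
  refine ⟨min h₁ (1 / 2), lt_min hh₁ (by norm_num), (min_le_right _ _).trans_lt (by norm_num), ?_⟩
  intro h hh hhle θ τ a hθ hτ ha r hr hra
  have hh1 : h ≤ 1 := hhle.trans ((min_le_right _ _).trans (by norm_num))
  obtain ⟨⟨⟨⟨⟨e1, e2⟩, e3⟩, e4⟩, e5⟩, e6⟩ := hev ⟨hh, hhle.trans (min_le_left _ _)⟩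
  have hpar := parameter_identities (τ₀ := τ₀) hα hh
  simp only [← hθ, ← hτ] at hpar
  obtain ⟨i1, i2, i3, i4, i5⟩ := hpar
  rw [one_mul] at e1 e5 e6
  rw [Real.rpow_two] at e1 e2 e3
  rw [← i3] at e4
  rw [← i4] at e5
  rw [← i5] at e6
  have hθ0 : 0 < θ := hθ ▸ Real.rpow_pos_of_pos hh _
  have hθ1 : θ ≤ 1 := hθ ▸ Real.rpow_le_one hh.le hh1 (by positivity)
  have hw1 : 1 ≤ θ ^ (α - 1) := Real.one_le_rpow_of_pos_of_le_one_of_nonpos hθ0 hθ1 (by linarith)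
  have hτ0 : 0 < τ := by rw [hτ]; positivity
  have hL : τ₀ ^ 2 ≤ τ₀ ^ ℓ := by
    rw [← Real.rpow_two]
    exact Real.rpow_le_rpow_of_exponent_le hτ₀1 hℓ1.le
  have hL1 : 1 ≤ τ₀ ^ ℓ := by nlinarith
  rw [Real.rpow_neg hh.le, Real.rpow_two] at ha
  have hinv : 1 ≤ (h ^ 2)⁻¹ := (one_le_inv₀ (by positivity)).2 (pow_le_one₀ hh.le hh1)
  have hha : (h ^ 2)⁻¹ ≤ a := by
    rw [ha]
    exact le_mul_of_one_le_left (by positivity) hL1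
  have ha1 : 1 ≤ a := hinv.trans hha
  have hRa : R ≤ a := by
    refine le_trans ?_ hha
    rwa [← one_div, le_div_iff₀ (by positivity)]
  have hr0 : 0 < r := hr₀.trans_le hr
  have hr3 : r ^ (-(3 : ℝ)) = (r ^ 3)⁻¹ := by
    rw [Real.rpow_neg hr0.le]
    norm_cast
  have hr4 : (r + 1) ^ (-(4 : ℝ)) = ((r + 1) ^ 4)⁻¹ := by
    rw [Real.rpow_neg (by linarith)]
    norm_cast
  rw [hr3, hr4, ge_iff_le]
  refine weighted_estimate hC hE hs1 hs2 hp0.le (fun r hr => hp_mono 0 r le_rfl hr) hR hr₀ hr hra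
    hτ₀1 (by linarith) (by linarith) hτ0 hh ha1 hRa hha hw1 i1 i2 hδ e1 e4 e6 e5 ?_ ?_
  · refine le_trans ?_ (e5.trans hδγ_le)
    rw [div_le_iff₀ (by positivity), i1]
    have hh2 : h * (h ^ 2)⁻¹ = h⁻¹ := by field_simp
    calc τ₀ ^ 2 * θ ^ (α - 1) ≤ τ₀ ^ ℓ * θ ^ (α - 1) * 1 := by rw [mul_one]; gcongr
      _ ≤ τ₀ ^ ℓ * θ ^ (α - 1) * h⁻¹ := by gcongr; exact (one_le_inv₀ hh).2 hh1
      _ = θ ^ (α - 1) * h * a := by rw [ha, ← hh2]; ring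
      _ ≤ θ ^ (α - 1) * h * (a + 1) := by gcongr; linarith
  · refine le_of_sq_le_sq (le_trans ?_ e2) hδγ.le
    rw [mul_pow, Real.sq_sqrt (by linarith)]
    calc (h ^ 2) ^ 2 * (a + 1) ≤ (h ^ 2) ^ 2 * (2 * a) := by gcongr; linarith
      _ = 2 * τ₀ ^ ℓ * h ^ 2 := by rw [ha]; field_simp
end

section
/- Let E > 0, 0 < α < 1, and let p : [0,∞) → (0,∞) be nonincreasing with p(r) → 0 as r → ∞. Set k = 1/2 and k₀ = 0, fix s with 1/2 < s < 3/4 and ℓ > 4 with (3 − 2s)ℓ > 2. For τ₀ ≥ 1 and 0 < h ≤ 1 put θ = h^{2/(α+3)}, τ = τ₀ θ^{2α/3} h^{−1/3} and a = τ₀^ℓ h^{−2}, let μ, φ, A be as in the context, and define B₁(r) = θ^{α−1}(r+1)^{−4} μ(r) + (p(r) + (r+1)^{−4}) μ′(r) and B₂(r) = (μ(r)(h^{−1}θ^{α}(r+1)^{−4} + |φ″(r)|))² / (h^{−1}φ′(r)μ(r) + μ′(r)). Then for all constants C > 0 and r₀ > 0 there exists τ₁ ≥ 1, depending only on C, E,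 r₀, α, p, s, ℓ, such that for all τ₀ ≥ τ₁, all 0 < h ≤ 1 and all r ≥ r₀ with r ≠ a: A(r) − h² r^{−3} μ(r) − C(B₁(r) + B₂(r)) ≥ −(2E/3) μ′(r). -/
open Real

lemma one_le_pow_mul_pow {δ t : ℝ} (hδ : 0 < δ) (hδ1 : δ ≤ 1) (ht : 1 ≤ t)
    (h : 1 ≤ δ ^ 3 * t) {m n : ℕ} (hm : m ≤ 3) (hn : n ≠ 0) : 1 ≤ δ ^ m * t ^ n :=
  h.trans (mul_le_mul (pow_le_pow_of_le_one hδ.le hδ1 hm) (le_self_pow₀ ht hn)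
    (by linarith) (by positivity))

lemma mul_sq_add_le_two_mul (r u v : ℝ) :
    (r * (u + v)) ^ 2 ≤ 2 * r ^ 2 * (u ^ 2 + v ^ 2) := by
  linarith [mul_nonneg (sq_nonneg r) (sq_nonneg (u - v))]

/-- The conjugated phase term `A` for `k = 1/2`, `k₀ = 0` is bounded below by a multiple of
`τ² (r + 1)⁻²`, up to a small error; here `x = (r + 1)^(-1/2)` and `b = (a + 1)^(-1/2)`. -/
lemma quarter_sub_le_phase_product {x b τ δ : ℝ} (hx1 : x ≤ 1) (hb : 0 < b)
    (hbx : b ≤ x) (hδ : 0 < δ) (hτb : τ ^ 6 * b ^ 4 ≤ δ ^ 3) :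
    τ ^ 2 * x ^ 4 / 4 - 3 * δ ≤ τ ^ 2 * ((x - b) * (x ^ 3 - b)) := by
  have hx : 0 < x := hb.trans_le hbx
  rcases le_or_gt (2 * b) (x ^ 3) with h | h
  · have h3 : x ^ 3 ≤ x := by
      simpa using pow_le_pow_of_le_one hx.le hx1 (show 1 ≤ 3 by norm_num)
    have h4 : x / 2 * (x ^ 3 / 2) ≤ (x - b) * (x ^ 3 - b) :=
      mul_le_mul (by linarith) (by linarith) (by positivity) (by linarith)
    nlinarith [mul_le_mul_of_nonneg_left h4 (sq_nonneg τ)]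
  · have hT : τ ^ 2 * x ^ 4 ≤ 3 * δ := by
      refine le_of_pow_le_pow_left₀ (n := 3) (by norm_num) (by positivity) ?_
      have h4 : (x ^ 3) ^ 4 ≤ (2 * b) ^ 4 := by gcongr
      calc (τ ^ 2 * x ^ 4) ^ 3 = τ ^ 6 * (x ^ 3) ^ 4 := by ring
        _ ≤ τ ^ 6 * (2 * b) ^ 4 := by gcongr
        _ = 16 * (τ ^ 6 * b ^ 4) := by ring
        _ ≤ 16 * δ ^ 3 := by gcongr
        _ ≤ (3 * δ) ^ 3 := by nlinarith [pow_pos hδ 3]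
    have hU : τ ^ 2 * (x * b) ≤ 2 * δ := by
      refine le_of_pow_le_pow_left₀ (n := 3) (by norm_num) (by positivity) ?_
      calc (τ ^ 2 * (x * b)) ^ 3 = τ ^ 6 * (x ^ 3 * b ^ 3) := by ring
        _ ≤ τ ^ 6 * (2 * b * b ^ 3) := by gcongr
        _ = 2 * (τ ^ 6 * b ^ 4) := by ring
        _ ≤ 2 * δ ^ 3 := by gcongr
        _ ≤ (2 * δ) ^ 3 := by nlinarith [pow_pos hδ 3]
    have h5 : -(x * b) ≤ (x - b) * (x ^ 3 - b) := by
      nlinarith [mul_nonneg (sub_nonneg.2 hbx) (pow_pos hx 3).le, mul_pos hb hb]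
    nlinarith [mul_le_mul_of_nonneg_left h5 (sq_nonneg τ)]

/-- The quotient term `B₂` inside the ball `r < a`, for `k = 1/2` and `k₀ = 0`, away from the
boundary of the ball. -/
lemma quotient_term_le_of_two_mul_le {r x b h τ₀ τ Q δ : ℝ} (hr : 0 < r) (hx : 0 < x)
    (hx1 : x ≤ 1) (hrx : r * x ^ 2 ≤ 1) (hbx : 2 * b ≤ x) (hh : 0 < h) (hh1 : h ≤ 1)
    (hτ₀ : 1 ≤ τ₀) (hτ : τ₀ ≤ τ) (hQ : 0 < Q) (hQ1 : Q ≤ 1)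
    (hτ3 : τ ^ 3 = τ₀ ^ 3 * Q ^ 2 * h⁻¹) (hδ : 0 < δ) (hδ1 : δ ≤ 1) (hδτ : 1 ≤ δ ^ 3 * τ₀) :
    (r * (h⁻¹ * Q * x ^ 8 + τ * x ^ 3 / 2)) ^ 2 / (h⁻¹ * (τ * (x - b)) * r + 1)
      ≤ 10 * δ * (1 + τ ^ 2 * x ^ 4) := by
  have hτ0 : 0 < τ := by linarith
  have hden : h⁻¹ * (τ * (x / 2)) * r ≤ h⁻¹ * (τ * (x - b)) * r + 1 := by
    have : h⁻¹ * (τ * (x / 2)) * r ≤ h⁻¹ * (τ * (x - b)) * r := by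
      gcongr; linarith
    linarith
  have hden0 : 0 < h⁻¹ * (τ * (x / 2)) * r := by positivity
  refine (div_le_div_of_nonneg_left (sq_nonneg _) hden0 hden).trans ?_
  have hQ2 : h⁻¹ * Q ^ 2 = τ ^ 3 / τ₀ ^ 3 := by
    rw [hτ3]; field_simp
  have hdiv : (r * (h⁻¹ * Q * x ^ 8 + τ * x ^ 3 / 2)) ^ 2 / (h⁻¹ * (τ * (x / 2)) * r)
      ≤ 4 * τ ^ 2 * x ^ 13 / τ₀ ^ 3 + τ * h * x ^ 3 := by
    rw [div_le_iff₀ hden0]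
    calc (r * (h⁻¹ * Q * x ^ 8 + τ * x ^ 3 / 2)) ^ 2
        ≤ 2 * r ^ 2 * ((h⁻¹ * Q * x ^ 8) ^ 2 + (τ * x ^ 3 / 2) ^ 2) :=
          mul_sq_add_le_two_mul _ _ _
      _ = (r * x ^ 2) * (r * (2 * h⁻¹ * (h⁻¹ * Q ^ 2) * x ^ 14 + τ ^ 2 * x ^ 4 / 2)) := by
          ring
      _ ≤ 1 * (r * (2 * h⁻¹ * (h⁻¹ * Q ^ 2) * x ^ 14 + τ ^ 2 * x ^ 4 / 2)) := by
          gcongr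
      _ = (4 * τ ^ 2 * x ^ 13 / τ₀ ^ 3 + τ * h * x ^ 3) * (h⁻¹ * (τ * (x / 2)) * r) := by
          rw [hQ2]; field_simp; ring
  refine hdiv.trans ?_
  have h1 : 4 * τ ^ 2 * x ^ 13 / τ₀ ^ 3 ≤ 4 * δ * (τ ^ 2 * x ^ 4) := by
    rw [div_le_iff₀ (by positivity)]
    have e1 : x ^ 13 ≤ x ^ 4 := pow_le_pow_of_le_one hx.le hx1 (by norm_num)
    have e2 : 1 ≤ δ ^ 1 * τ₀ ^ 3 :=
      one_le_pow_mul_pow hδ hδ1 hτ₀ hδτ (by norm_num) (by norm_num)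
    calc 4 * τ ^ 2 * x ^ 13 ≤ 4 * τ ^ 2 * x ^ 4 * 1 := by
          rw [mul_one]; gcongr
      _ ≤ 4 * τ ^ 2 * x ^ 4 * (δ ^ 1 * τ₀ ^ 3) := by gcongr
      _ = _ := by ring
  have h2 : τ * h ≤ τ₀ := by
    refine le_of_pow_le_pow_left₀ (n := 3) (by norm_num) (by positivity) ?_
    calc (τ * h) ^ 3 = τ ^ 3 * h ^ 3 := by ring
      _ = τ₀ ^ 3 * (Q ^ 2 * h ^ 2) := by rw [hτ3]; field_simp
      _ ≤ τ₀ ^ 3 * (1 ^ 2 * 1 ^ 2) := by gcongr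
      _ = τ₀ ^ 3 := by ring
  have h3 : τ₀ * x ^ 3 ≤ δ * (1 + (τ₀ * x ^ 2) ^ 2) := by
    refine le_of_pow_le_pow_left₀ (n := 2) (by norm_num) (by positivity) ?_
    have e0 : 1 ≤ δ ^ 2 * τ₀ ^ 1 :=
      one_le_pow_mul_pow hδ hδ1 hτ₀ hδτ (by norm_num) (by norm_num)
    have e1 : ∀ u : ℝ, 0 < u → u ^ 3 ≤ (1 + u ^ 2) ^ 2 := fun u hu => by
      nlinarith [sq_nonneg (u ^ 2 - u), pow_pos hu 3]
    calc (τ₀ * x ^ 3) ^ 2 = τ₀ ^ 2 * x ^ 6 * 1 := by ring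
      _ ≤ τ₀ ^ 2 * x ^ 6 * (δ ^ 2 * τ₀ ^ 1) := by gcongr
      _ = δ ^ 2 * (τ₀ * x ^ 2) ^ 3 := by ring
      _ ≤ δ ^ 2 * (1 + (τ₀ * x ^ 2) ^ 2) ^ 2 := by
          gcongr
          exact e1 _ (by positivity)
      _ = _ := by ring
  have h4 : (τ₀ * x ^ 2) ^ 2 ≤ τ ^ 2 * x ^ 4 := by
    calc (τ₀ * x ^ 2) ^ 2 = τ₀ ^ 2 * x ^ 4 := by ring
      _ ≤ _ := by gcongr
  have h5 : τ * h * x ^ 3 ≤ τ₀ * x ^ 3 := by gcongr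
  have hT : 0 ≤ δ * (τ ^ 2 * x ^ 4) := by positivity
  linarith [mul_le_mul_of_nonneg_left h4 hδ.le]

/-- The quotient term `B₂` inside the ball `r < a`, for `k = 1/2` and `k₀ = 0`, near the
boundary of the ball. -/
lemma quotient_term_le_of_le_two_mul {r x b h τ₀ τ Q δ : ℝ} (hr : 0 < r) (hb : 0 < b)
    (hbx : b ≤ x) (hx1 : x ≤ 1) (hrx : r * x ^ 2 ≤ 1) (hxb : x ≤ 2 * b) (hh : 0 < h)
    (hτ₀ : 1 ≤ τ₀) (hτ : 0 < τ) (hQ : 0 < Q) (hQ1 : Q ≤ 1)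
    (hδ : 0 < δ) (hδ1 : δ ≤ 1) (hδτ : 1 ≤ δ ^ 3 * τ₀) (hbh : b ^ 2 * τ₀ ^ 4 ≤ h ^ 2)
    (hτb : τ ^ 6 * b ^ 4 ≤ δ ^ 3) :
    (r * (h⁻¹ * Q * x ^ 8 + τ * x ^ 3 / 2)) ^ 2 / (h⁻¹ * (τ * (x - b)) * r + 1)
      ≤ 10 * δ * (1 + τ ^ 2 * x ^ 4) := by
  have hx : 0 < x := hb.trans_le hbx
  have hden : 1 ≤ h⁻¹ * (τ * (x - b)) * r + 1 := by
    have : 0 ≤ x - b := by linarith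
    have : 0 ≤ h⁻¹ * (τ * (x - b)) * r := by positivity
    linarith
  refine (div_le_self (sq_nonneg _) hden).trans ?_
  have e1 : x ^ 2 ≤ (2 * b) ^ 2 := by gcongr
  have hx2 : h⁻¹ ^ 2 * x ^ 2 ≤ 4 * δ := by
    have e2 : 1 ≤ δ ^ 1 * τ₀ ^ 4 :=
      one_le_pow_mul_pow hδ hδ1 hτ₀ hδτ (by norm_num) (by norm_num)
    have e3 : b ^ 2 ≤ δ * h ^ 2 := by
      calc b ^ 2 = b ^ 2 * 1 := by ring
        _ ≤ b ^ 2 * (δ ^ 1 * τ₀ ^ 4) := by gcongr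
        _ = δ * (b ^ 2 * τ₀ ^ 4) := by ring
        _ ≤ _ := by gcongr
    calc h⁻¹ ^ 2 * x ^ 2 ≤ h⁻¹ ^ 2 * (4 * (δ * h ^ 2)) := by gcongr; linarith
      _ = 4 * δ := by field_simp
  have hτb2 : τ ^ 2 * b ^ 2 ≤ δ := by
    refine le_of_pow_le_pow_left₀ (n := 3) (by norm_num) hδ.le ?_
    have e4 : b ^ 6 ≤ b ^ 4 := pow_le_pow_of_le_one hb.le (hbx.trans hx1) (by norm_num)
    calc (τ ^ 2 * b ^ 2) ^ 3 = τ ^ 6 * b ^ 6 := by ring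
      _ ≤ τ ^ 6 * b ^ 4 := by gcongr
      _ ≤ δ ^ 3 := hτb
  have hτx2 : τ ^ 2 * x ^ 2 ≤ 4 * δ := by
    linarith [mul_le_mul_of_nonneg_left e1 (sq_nonneg τ)]
  have hQx : Q ^ 2 * x ^ 10 ≤ 1 := mul_le_one₀ (pow_le_one₀ hQ.le hQ1) (by positivity)
    (pow_le_one₀ hx.le hx1)
  calc (r * (h⁻¹ * Q * x ^ 8 + τ * x ^ 3 / 2)) ^ 2
      ≤ 2 * r ^ 2 * ((h⁻¹ * Q * x ^ 8) ^ 2 + (τ * x ^ 3 / 2) ^ 2) :=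
        mul_sq_add_le_two_mul _ _ _
    _ = (r * x ^ 2) ^ 2 * (2 * ((h⁻¹ ^ 2 * x ^ 2) * (Q ^ 2 * x ^ 10)) + τ ^ 2 * x ^ 2 / 2) := by
        ring
    _ ≤ 1 ^ 2 * (2 * ((4 * δ) * 1) + (4 * δ) / 2) := by gcongr
    _ = 10 * δ * 1 := by ring
    _ ≤ _ := by
        gcongr
        have : 0 ≤ τ ^ 2 * x ^ 4 := by positivity
        linarith

/-- A function tending to zero which is nonincreasing on `[0, ∞)` is at most `ε` up to a multiple
of `(r + 1)⁻²`. -/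
lemma exists_le_add_mul_pow {p : ℝ → ℝ} (hp_mono : ∀ r r' : ℝ, 0 ≤ r → r ≤ r' → p r' ≤ p r)
    (hp_lim : Filter.Tendsto p Filter.atTop (nhds 0)) {ε : ℝ} (hε : 0 < ε) :
    ∃ K : ℝ, 0 ≤ K ∧ ∀ r x : ℝ, 0 ≤ r → x ^ 2 * (r + 1) = 1 → p r ≤ ε + K * x ^ 4 := by
  obtain ⟨R, hR⟩ := Filter.eventually_atTop.1 (hp_lim.eventually_lt_const hε)
  refine ⟨|p 0| * (|R| + 1) ^ 2, by positivity, fun r x hr hx => ?_⟩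
  rcases le_or_gt R r with h | h
  · have := hR r h
    have : 0 ≤ |p 0| * (|R| + 1) ^ 2 * x ^ 4 := by positivity
    linarith
  · have h1 : r + 1 ≤ |R| + 1 := by linarith [le_abs_self R]
    have h2 : 1 ≤ (x ^ 2 * (|R| + 1)) ^ 2 :=
      one_le_pow₀ (hx.symm.le.trans (mul_le_mul_of_nonneg_left h1 (sq_nonneg x)))
    have h3 := hp_mono 0 r le_rfl hr
    nlinarith [mul_le_mul_of_nonneg_left h2 (abs_nonneg (p 0)), le_abs_self (p 0)]

/-- The combined estimate inside the ball `r < a`. -/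
lemma interior_estimate {E C r r₀ x b h τ₀ τ P Q δ q ε K : ℝ} (hr₀ : 0 < r₀) (hr : r₀ ≤ r)
    (hx1 : x ≤ 1) (hrx : x ^ 2 * (r + 1) = 1) (hb : 0 < b) (hbx : b ≤ x)
    (hh : 0 < h) (hh1 : h ≤ 1) (hτ₀ : 1 ≤ τ₀) (hP1 : 1 ≤ P) (hQ : 0 < Q) (hQ1 : Q ≤ 1)
    (hτ : 0 < τ) (hτ2 : τ ^ 2 = τ₀ ^ 2 * P) (hτ3 : τ ^ 3 = τ₀ ^ 3 * Q ^ 2 * h⁻¹)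
    (hδ : 0 < δ) (hδ1 : δ ≤ 1) (hδτ : 1 ≤ δ ^ 3 * τ₀) (hbh : b ^ 2 * τ₀ ^ 4 ≤ h ^ 2)
    (hC : 0 < C) (hCε : C * ε ≤ E / 3) (hK : 0 ≤ K) (hq : q ≤ ε + K * x ^ 4)
    (hδN : (3 + (1 + r₀⁻¹) ^ 2 + C * (12 + K)) * δ ≤ min (1 / 4) (E / 3)) :
    τ ^ 2 * ((x - b) * (x ^ 3 - b)) - h ^ 2 * (r ^ 3)⁻¹ * r
      - C * ((P * x ^ 8 * r + (q + x ^ 8))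
        + (r * (h⁻¹ * Q * x ^ 8 + τ * x ^ 3 / 2)) ^ 2 / (h⁻¹ * (τ * (x - b)) * r + 1))
      ≥ -(2 * E / 3) := by
  have hx : 0 < x := hb.trans_le hbx
  have hr0 : 0 < r := hr₀.trans_le hr
  have hττ : τ₀ ≤ τ := by
    refine le_of_pow_le_pow_left₀ (n := 2) (by norm_num) hτ.le ?_
    rw [hτ2]
    exact le_mul_of_one_le_right (by positivity) hP1
  have hτb : τ ^ 6 * b ^ 4 ≤ δ ^ 3 := by
    have e1 : τ ^ 6 * b ^ 4 * τ₀ ^ 2 ≤ 1 := by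
      calc τ ^ 6 * b ^ 4 * τ₀ ^ 2 = (τ ^ 3) ^ 2 * b ^ 4 * τ₀ ^ 2 := by ring
        _ = Q ^ 4 * h⁻¹ ^ 2 * (b ^ 2 * τ₀ ^ 4) ^ 2 := by rw [hτ3]; ring
        _ ≤ 1 ^ 4 * h⁻¹ ^ 2 * (h ^ 2) ^ 2 := by gcongr
        _ = h ^ 2 := by field_simp
        _ ≤ 1 := pow_le_one₀ hh.le hh1
    have e2 : 1 ≤ δ ^ 3 * τ₀ ^ 2 := one_le_pow_mul_pow hδ hδ1 hτ₀ hδτ le_rfl (by norm_num)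
    exact le_of_mul_le_mul_right (e1.trans e2) (by positivity)
  have hA := quarter_sub_le_phase_product hx1 hb hbx hδ hτb
  have hrx1 : r * x ^ 2 ≤ 1 := by linarith [sq_nonneg x]
  have hB := (le_total (2 * b) x).elim
    (fun hxb => quotient_term_le_of_two_mul_le hr0 hx hx1 hrx1 hxb hh hh1 hτ₀ hττ hQ hQ1 hτ3
      hδ hδ1 hδτ)
    (fun hxb => quotient_term_le_of_le_two_mul hr0 hb hbx hx1 hrx1 hxb hh hτ₀ hτ hQ hQ1
      hδ hδ1 hδτ hbh hτb)
  have hδ2 : 1 ≤ δ ^ 1 * τ₀ ^ 2 :=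
    one_le_pow_mul_pow hδ hδ1 hτ₀ hδτ (by norm_num) (by norm_num)
  have hPT : P * x ^ 4 ≤ δ * (τ ^ 2 * x ^ 4) := by
    rw [hτ2]
    linarith [mul_le_mul_of_nonneg_right hδ2 (show 0 ≤ P * x ^ 4 by positivity)]
  have hxT : x ^ 4 ≤ δ * (τ ^ 2 * x ^ 4) :=
    (le_mul_of_one_le_left (by positivity) hP1).trans hPT
  have h1 : h ^ 2 * (r ^ 3)⁻¹ * r ≤ (1 + r₀⁻¹) ^ 2 * (δ * (τ ^ 2 * x ^ 4)) := by
    calc h ^ 2 * (r ^ 3)⁻¹ * r = h ^ 2 * (x ^ 2 * (r + 1)) ^ 2 * (r ^ 3)⁻¹ * r := by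
          rw [hrx]; ring
      _ = h ^ 2 * (1 + r⁻¹) ^ 2 * x ^ 4 := by field_simp
      _ ≤ 1 ^ 2 * (1 + r₀⁻¹) ^ 2 * x ^ 4 := by gcongr
      _ = (1 + r₀⁻¹) ^ 2 * x ^ 4 := by ring
      _ ≤ _ := by gcongr
  have h2 : P * x ^ 8 * r ≤ δ * (τ ^ 2 * x ^ 4) := by
    have e : r * x ^ 4 ≤ 1 := by
      calc r * x ^ 4 = r * x ^ 2 * x ^ 2 := by ring
        _ ≤ 1 := mul_le_one₀ hrx1 (by positivity) (pow_le_one₀ hx.le hx1)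
    calc P * x ^ 8 * r = P * x ^ 4 * (r * x ^ 4) := by ring
      _ ≤ P * x ^ 4 := mul_le_of_le_one_right (by positivity) e
      _ ≤ _ := hPT
  have h3 : x ^ 8 ≤ x ^ 4 := pow_le_pow_of_le_one hx.le hx1 (by norm_num)
  have h4 := mul_le_mul_of_nonneg_left hxT hK
  set T := τ ^ 2 * x ^ 4
  have hT : 0 ≤ T := by positivity
  have h5 := mul_le_mul_of_nonneg_left (add_le_add (add_le_add h2 (add_le_add hq h3)) hB) hC.le
  have h6 := mul_le_mul_of_nonneg_right (hδN.trans (min_le_left _ _)) hT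
  have h7 := hδN.trans (min_le_right _ _)
  have h8 : 0 ≤ (1 + r₀⁻¹) ^ 2 * δ := by positivity
  have h9 := mul_le_mul_of_nonneg_left hxT hC.le
  have h10 : 0 ≤ C * δ := by positivity
  have h11 : 0 ≤ C * δ * K := by positivity
  have h12 : 0 ≤ δ * T := by positivity
  linarith [mul_le_mul_of_nonneg_left h4 hC.le]

/-- The combined estimate outside the ball, where the phase is constant. Here `m` and `M` stand
for the values of the weight and of its derivative. -/
lemma exterior_estimate {E C r x h τ₀ P Q δ q ε K m M c : ℝ} (hr1 : 1 ≤ r)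
    (hx : 0 < x) (hrx : x ^ 2 * (r + 1) = 1)
    (hh : 0 < h) (hh1 : h ≤ 1) (hτ₀ : 1 ≤ τ₀) (hP : 0 < P) (hPh : P * h ^ 2 ≤ 1)
    (hQ : 0 < Q) (hQ1 : Q ≤ 1)
    (hδ : 0 < δ) (hδ1 : δ ≤ 1) (hδτ : 1 ≤ δ ^ 3 * τ₀) (hxh : x ^ 2 * τ₀ ^ 4 ≤ h ^ 2)
    (hC : 0 < C) (hCε : C * ε ≤ E / 3) (hK : 0 ≤ K) (hq : q ≤ ε + K * x ^ 4)
    (hm : 0 ≤ m) (hmr : m ≤ r + 1) (hM : 0 < M) (hc : 0 < c) (hxM : x ^ 3 ≤ c * M)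
    (hδN : (8 * c + C * (c + 1 + K + c ^ 2)) * δ ≤ E / 3) :
    0 - h ^ 2 * (r ^ 3)⁻¹ * m
      - C * ((P * x ^ 8 * m + (q + x ^ 8) * M)
        + (m * (h⁻¹ * Q * x ^ 8)) ^ 2 / M)
      ≥ -(2 * E / 3) * M := by
  have hδ2 : 1 ≤ δ ^ 2 * τ₀ ^ 4 := one_le_pow_mul_pow hδ hδ1 hτ₀ hδτ (by norm_num) (by norm_num)
  have hxδh : x ≤ δ * h := by
    refine le_of_pow_le_pow_left₀ (n := 2) (by norm_num) (by positivity) ?_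
    calc x ^ 2 = x ^ 2 * 1 := by ring
      _ ≤ x ^ 2 * (δ ^ 2 * τ₀ ^ 4) := by gcongr
      _ = δ ^ 2 * (x ^ 2 * τ₀ ^ 4) := by ring
      _ ≤ δ ^ 2 * h ^ 2 := by gcongr
      _ = _ := by ring
  have hxδ : x ≤ δ := hxδh.trans (mul_le_of_le_one_right hδ.le hh1)
  have hxh' : x ≤ h := hxδh.trans (mul_le_of_le_one_left hh.le hδ1)
  have hx1 : x ≤ 1 := hxδ.trans hδ1
  have hmx : m * x ^ 2 ≤ 1 := by linarith [mul_le_mul_of_nonneg_right hmr (sq_nonneg x)]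
  have h1 : h ^ 2 * (r ^ 3)⁻¹ * m ≤ 8 * c * δ * M := by
    have e1 : (r ^ 3)⁻¹ ≤ 8 * x ^ 6 := by
      have e2 : 1 ≤ x ^ 2 * (2 * r) := by nlinarith [sq_nonneg x]
      have e3 := one_le_pow₀ (n := 3) e2
      rw [inv_le_iff_one_le_mul₀ (by positivity)]
      linarith [show (x ^ 2 * (2 * r)) ^ 3 = 8 * x ^ 6 * r ^ 3 by ring]
    calc h ^ 2 * (r ^ 3)⁻¹ * m ≤ 1 ^ 2 * (8 * x ^ 6) * m := by gcongr
      _ = 8 * x ^ 3 * x * (m * x ^ 2) := by ring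
      _ ≤ 8 * (c * M) * δ * 1 := by gcongr
      _ = _ := by ring
  have h2 : P * x ^ 8 * m ≤ c * δ * M := by
    calc P * x ^ 8 * m = P * x ^ 2 * x * x ^ 3 * (m * x ^ 2) := by ring
      _ ≤ P * h ^ 2 * δ * (c * M) * 1 := by gcongr
      _ ≤ 1 * δ * (c * M) * 1 := by gcongr
      _ = _ := by ring
  have h3 : ∀ n : ℕ, n ≠ 0 → x ^ n ≤ δ := fun n hn => (pow_le_of_le_one hx.le hx1 hn).trans hxδ
  have h4 : (m * (h⁻¹ * Q * x ^ 8)) ^ 2 / M ≤ c ^ 2 * δ * M := by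
    rw [div_le_iff₀ hM]
    have e1 : h⁻¹ * x ≤ 1 := by rw [inv_mul_le_iff₀ hh]; linarith
    have e2 : x ^ 4 ≤ δ := h3 4 (by norm_num)
    calc (m * (h⁻¹ * Q * x ^ 8)) ^ 2
        = (m * x ^ 2) ^ 2 * (h⁻¹ * x) ^ 2 * Q ^ 2 * x ^ 4 * (x ^ 3) ^ 2 := by ring
      _ ≤ 1 ^ 2 * 1 ^ 2 * 1 ^ 2 * δ * (c * M) ^ 2 := by gcongr
      _ = _ := by ring
  have h5 : (q + x ^ 8) * M ≤ (ε + (K + 1) * δ) * M := by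
    refine mul_le_mul_of_nonneg_right ?_ hM.le
    linarith [h3 8 (by norm_num), mul_le_mul_of_nonneg_left (h3 4 (by norm_num)) hK]
  have h6 := mul_le_mul_of_nonneg_left (add_le_add (add_le_add h2 h5) h4) hC.le
  have h7 := mul_le_mul_of_nonneg_right hδN hM.le
  have h8 := mul_le_mul_of_nonneg_right hCε hM.le
  linarith

/-- The scaling relations between the semiclassical parameters. -/
lemma scaling_relations {α h τ₀ ℓ θ τ a : ℝ} (hα : 0 < α) (hα1 : α < 1) (hh : 0 < h)
    (hh1 : h ≤ 1) (hτ₀ : 1 ≤ τ₀) (hℓ : 4 < ℓ) (hθ : θ = h ^ (2 / (α + 3)))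
    (hτ : τ = τ₀ * θ ^ (2 * α / 3) * h ^ (-(1 / 3) : ℝ)) (ha : a = τ₀ ^ ℓ * h ^ (-(2 : ℝ))) :
    0 < τ ∧ 1 ≤ θ ^ (α - 1) ∧ 0 < θ ^ α ∧ θ ^ α ≤ 1 ∧ θ ^ (α - 1) * h ^ 2 ≤ 1 ∧
      τ ^ 2 = τ₀ ^ 2 * θ ^ (α - 1) ∧ τ ^ 3 = τ₀ ^ 3 * (θ ^ α) ^ 2 * h⁻¹ ∧
      τ₀ ^ 4 ≤ a * h ^ 2 := by
  have hα3 : 0 < α + 3 := by linarith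
  have hθ0 : 0 < θ := by rw [hθ]; positivity
  have hθ1 : θ ≤ 1 := by rw [hθ]; exact rpow_le_one hh.le hh1 (by positivity)
  refine ⟨by rw [hτ]; positivity,
    one_le_rpow_of_pos_of_le_one_of_nonpos hθ0 hθ1 (by linarith), by positivity,
    rpow_le_one hθ0.le hθ1 hα.le, ?_, ?_, ?_, ?_⟩
  · rw [hθ, ← rpow_mul hh.le, ← rpow_natCast h 2, ← rpow_add hh]
    refine rpow_le_one hh.le hh1 ?_
    have : 2 / (α + 3) * (α - 1) + ((2 : ℕ) : ℝ) = (4 * α + 4) / (α + 3) := by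
      push_cast; field_simp; ring
    rw [this]
    positivity
  · rw [hτ, mul_pow, mul_pow, hθ, mul_assoc]
    congr 1
    rw [← rpow_natCast, ← rpow_natCast, ← rpow_mul hh.le, ← rpow_mul hh.le, ← rpow_mul hh.le,
      ← rpow_mul hh.le, ← rpow_add hh]
    congr 1
    push_cast
    field_simp
    ring
  · rw [hτ, mul_pow, mul_pow]
    congr 1
    · congr 1
      rw [← rpow_natCast, ← rpow_natCast, ← rpow_mul hθ0.le, ← rpow_mul hθ0.le]
      congr 1
      push_cast
      ring
    · rw [← rpow_natCast, ← rpow_mul hh.le, ← rpow_neg_one]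
      congr 1
      push_cast
      ring
  · have e : a * h ^ 2 = τ₀ ^ ℓ := by
      rw [ha, rpow_neg hh.le, rpow_two]
      field_simp
    rw [e, ← rpow_natCast τ₀ 4]
    exact rpow_le_rpow_of_exponent_le hτ₀ (by push_cast; linarith)

lemma rpow_neg_half_sq_mul {y : ℝ} (hy : 0 < y) : (y ^ (-(1 / 2) : ℝ)) ^ 2 * y = 1 := by
  rw [← rpow_natCast, ← rpow_mul hy.le]
  norm_num
  rw [rpow_neg_one]
  field_simp

lemma rpow_neg_half_pow {y : ℝ} (hy : 0 < y) (n : ℕ) :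
    (y ^ (-(1 / 2) : ℝ)) ^ n = y ^ (-(n / 2 : ℝ)) := by
  rw [← rpow_natCast, ← rpow_mul hy.le]
  ring_nf

lemma exists_pos_le_one_mul_le_mul_le (A B : ℝ) {η ζ : ℝ} (hη : 0 < η) (hζ : 0 < ζ) :
    ∃ δ : ℝ, 0 < δ ∧ δ ≤ 1 ∧ A * δ ≤ η ∧ B * δ ≤ ζ := by
  have lim : ∀ D : ℝ, Filter.Tendsto (fun δ => D * δ) (nhdsWithin 0 (Set.Ioi 0)) (nhds 0) :=
    fun D => ((continuous_const_mul D).tendsto' 0 0 (mul_zero D)).mono_left nhdsWithin_le_nhds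
  obtain ⟨δ, ⟨⟨hδ, hδ1⟩, hA⟩, hB⟩ := (((eventually_mem_nhdsWithin.and
    ((lim 1).eventually_le_const one_pos)).and ((lim A).eventually_le_const hη)).and
      ((lim B).eventually_le_const hζ)).exists
  exact ⟨δ, hδ, by simpa using hδ1, hA, hB⟩

/-- Lemma 2.5: the Hölder case with parameters k = 1/2, k₀ = 0, valid for all
h ∈ (0,1]. -/
theorem stmt_10 (E α : ℝ) (hE : 0 < E) (hα : 0 < α) (hα1 : α < 1)
    (p : ℝ → ℝ) (hp_pos : ∀ r : ℝ, 0 ≤ r → 0 < p r)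
    (hp_mono : ∀ r r' : ℝ, 0 ≤ r → r ≤ r' → p r' ≤ p r)
    (hp_lim : Filter.Tendsto p Filter.atTop (nhds 0))
    (k k₀ s ℓ : ℝ) (hk : k = 1/2) (hk₀ : k₀ = 0)
    (hs1 : 1/2 < s) (hs2 : s < 3/4)
    (hℓ1 : 4 < ℓ) (hℓ2 : (3 - 2*s) * ℓ > 2) :
    ∀ C r₀ : ℝ, 0 < C → 0 < r₀ → ∃ τ₁ : ℝ, 1 ≤ τ₁ ∧
      ∀ τ₀ : ℝ, τ₁ ≤ τ₀ → ∀ h : ℝ, 0 < h → h ≤ 1 →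
        ∀ θ τ a : ℝ, θ = h ^ (2/(α+3)) → τ = τ₀ * θ ^ (2*α/3) * h ^ (-(1/3) : ℝ) →
          a = τ₀ ^ ℓ * h ^ (-(2:ℝ)) →
          ∀ r : ℝ, r₀ ≤ r → r ≠ a →
            Afun k k₀ s τ a r - h ^ 2 * r ^ (-(3:ℝ)) * mu k k₀ s a r
              - C * ((θ ^ (α - 1) * (r + 1) ^ (-(4:ℝ)) * mu k k₀ s a r
                    + (p r + (r + 1) ^ (-(4:ℝ))) * muDeriv k k₀ s a r)
                + (mu k k₀ s a r * (h⁻¹ * θ ^ α * (r + 1) ^ (-(4:ℝ)) + |phiDeriv2 k τ a r|)) ^ 2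
                  / (h⁻¹ * phiDeriv k τ a r * mu k k₀ s a r + muDeriv k k₀ s a r))
            ≥ -(2*E/3) * muDeriv k k₀ s a r := by
  intro C r₀ hC hr₀
  obtain ⟨K, hK, hpK⟩ := exists_le_add_mul_pow hp_mono hp_lim (show 0 < E / (3 * C) by positivity)
  have hCε : C * (E / (3 * C)) ≤ E / 3 := by
    apply le_of_eq
    field_simp
  set c : ℝ := (2 * s - 1)⁻¹ with hc
  have hs0 : 0 < 2 * s - 1 := by linarith
  have hc0 : 0 < c := by positivity
  obtain ⟨δ, hδ, hδ1, hint, hext⟩ := exists_pos_le_one_mul_le_mul_le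
    (3 + (1 + r₀⁻¹) ^ 2 + C * (12 + K)) (8 * c + C * (c + 1 + K + c ^ 2))
    (show 0 < min (1 / 4) (E / 3) from lt_min (by norm_num) (by positivity))
    (show 0 < E / 3 by positivity)
  refine ⟨(δ ^ 3)⁻¹, one_le_inv_iff₀.2 ⟨by positivity, pow_le_one₀ hδ.le hδ1⟩, ?_⟩
  intro τ₀ hτ₀ h hh hh1 θ τ a hθ hτ ha r hr hra
  have hδτ : 1 ≤ δ ^ 3 * τ₀ := by rwa [inv_le_iff_one_le_mul₀' (by positivity)] at hτ₀
  have hτ₀1 : 1 ≤ τ₀ :=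
    (one_le_inv_iff₀.2 ⟨by positivity, pow_le_one₀ hδ.le hδ1⟩).trans hτ₀
  obtain ⟨hτ0, hP1, hQ, hQ1, hPh, hτ2, hτ3, hah⟩ :=
    scaling_relations hα hα1 hh hh1 hτ₀1 hℓ1 hθ hτ ha
  have hr0 : 0 < r := hr₀.trans_le hr
  have ha0 : 0 < a := by rw [ha]; positivity
  have ha1 : 1 ≤ a := (one_le_pow₀ hτ₀1).trans
    (hah.trans (mul_le_of_le_one_right ha0.le (pow_le_one₀ hh.le hh1)))
  have hr1 : 0 < r + 1 := by linarith
  have hx1 : (r + 1) ^ (-(1 / 2) : ℝ) ≤ 1 :=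
    rpow_le_one_of_one_le_of_nonpos (by linarith) (by norm_num)
  have hrx := rpow_neg_half_sq_mul hr1
  have hx8 : (r + 1) ^ (-(4 : ℝ)) = ((r + 1) ^ (-(1 / 2) : ℝ)) ^ 8 := by
    rw [rpow_neg_half_pow hr1]; norm_num
  have hx3 : (r + 1) ^ (-(1 / 2) - 1 : ℝ) = ((r + 1) ^ (-(1 / 2) : ℝ)) ^ 3 := by
    rw [rpow_neg_half_pow hr1]; norm_num
  have hr3 : r ^ (-(3 : ℝ)) = (r ^ 3)⁻¹ := by
    rw [rpow_neg hr0.le]; norm_cast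
  have hx0 : 0 < (r + 1) ^ (-(1 / 2) : ℝ) := by positivity
  have hq := hpK r _ hr0.le hrx
  subst hk hk₀
  rcases lt_or_gt_of_ne hra with hlt | hgt
  · have hb : 0 < (a + 1) ^ (-(1 / 2) : ℝ) := by positivity
    have hbx : (a + 1) ^ (-(1 / 2) : ℝ) ≤ (r + 1) ^ (-(1 / 2) : ℝ) :=
      rpow_le_rpow_of_nonpos hr1 (by linarith) (by norm_num)
    have hab := rpow_neg_half_sq_mul (show 0 < a + 1 by linarith)
    rw [hx8, hr3]
    simp only [Afun, mu, muDeriv, phiDeriv, phiDeriv2, if_pos hlt, if_pos hlt.le, hx3]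
    generalize (r + 1) ^ (-(1 / 2) : ℝ) = x at *
    generalize (a + 1) ^ (-(1 / 2) : ℝ) = b at *
    have hbh : b ^ 2 * τ₀ ^ 4 ≤ h ^ 2 := by
      have : b ^ 2 * a ≤ 1 := by linarith [sq_nonneg b]
      linarith [mul_le_mul_of_nonneg_left hah (sq_nonneg b),
        mul_le_mul_of_nonneg_right this (sq_nonneg h)]
    have key := interior_estimate (E := E) hr₀ hr hx1 hrx hb hbx hh hh1 hτ₀1 hP1 hQ hQ1 hτ0 hτ2
      hτ3 hδ hδ1 hδτ hbh hC hCε hK hq hint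
    have hm : (r + 1) ^ (2 * (1 / 2) : ℝ) - (r + 1) ^ (2 * 0 : ℝ) = r := by norm_num
    have hm' : 2 * (1 / 2) * (r + 1) ^ (2 * (1 / 2) - 1 : ℝ)
        - 2 * 0 * (r + 1) ^ (2 * 0 - 1 : ℝ) = 1 := by norm_num
    have habs : |-(1 / 2 * τ) * x ^ 3| = τ * x ^ 3 / 2 := by
      rw [abs_of_nonpos (by linarith [mul_pos hτ0 (pow_pos hx0 3)])]
      ring
    have hA : 1 * (τ * (x - b)) ^ 2 + 2 * r * (τ * (x - b)) * (-(1 / 2 * τ) * x ^ 3)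
        = τ ^ 2 * ((x - b) * (x ^ 3 - b)) := by
      have : r * x ^ 3 = x - x ^ 3 := by linear_combination x * hrx
      linear_combination (-τ ^ 2 * (x - b)) * this
    rw [hm, hm', habs, hA, mul_one, mul_one]
    exact key
  · have hxh : ((r + 1) ^ (-(1 / 2) : ℝ)) ^ 2 * τ₀ ^ 4 ≤ h ^ 2 := by
      have e1 : ((r + 1) ^ (-(1 / 2) : ℝ)) ^ 2 * a ≤ 1 :=
        (mul_le_mul_of_nonneg_left (by linarith) (sq_nonneg _)).trans hrx.le
      linarith [mul_le_mul_of_nonneg_left hah (sq_nonneg ((r + 1) ^ (-(1 / 2) : ℝ))),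
        mul_le_mul_of_nonneg_right e1 (sq_nonneg h)]
    have hM : 0 < (2 * s - 1) * (r + 1) ^ (-(2 * s)) := by positivity
    have hxM : ((r + 1) ^ (-(1 / 2) : ℝ)) ^ 3 ≤ c * ((2 * s - 1) * (r + 1) ^ (-(2 * s))) := by
      rw [hc, inv_mul_cancel_left₀ hs0.ne', rpow_neg_half_pow hr1]
      exact rpow_le_rpow_of_exponent_le (by linarith) (by push_cast; linarith)
    have hdec : (r + 1) ^ (1 - 2 * s) ≤ (a + 1) ^ (1 - 2 * s) :=
      rpow_le_rpow_of_nonpos (by linarith) (by linarith) (by linarith)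
    have hle1 : (a + 1) ^ (1 - 2 * s) ≤ 1 :=
      rpow_le_one_of_one_le_of_nonpos (by linarith) (by linarith)
    have hpos : 0 < (r + 1) ^ (1 - 2 * s) := by positivity
    have hm : (a + 1) ^ (2 * (1 / 2) : ℝ) - (a + 1) ^ (2 * 0 : ℝ) = a := by norm_num
    have key := exterior_estimate (E := E)
      (m := a + (a + 1) ^ (1 - 2 * s) - (r + 1) ^ (1 - 2 * s)) (by linarith) hx0 hrx hh hh1
      hτ₀1 (by linarith) hPh hQ hQ1 hδ hδ1 hδτ hxh hC hCε hK hq (by linarith) (by linarith) hM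
      hc0 hxM hext
    rw [hx8, hr3]
    simp only [Afun, mu, muDeriv, phiDeriv, phiDeriv2, if_neg hgt.not_gt, if_neg hgt.not_ge, hm]
    simpa using key
end
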